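/- Let p ≠ 3 be prime. For each of the six splitting types τ ∈ {(0),(1³),(1²1),(111),(12),(3)} let C_τ be the indicator function of the orbit of type τ in V(𝔽_p) and C*_τ the indicator of the dual orbit of type τ in V*(𝔽_p). Then for every type τ_j, the Fourier transform of C_{τ_j} equals Σ_i m_{ij}·C*_{τ_i}, where M = (m_{ij}) = p^{-4} times the matrix with rows indexed by dual types and columns by types, both in the order ((0),(1³),(1²1),(111),(12),(3)): row (0) = (1, (p+1)(p−1), p(p+1)(p−1), p(p+1)(p−1)²/6, p(p+1)(p−1)²/2, p(p+1)(p−1)²/3); row (1³) = (1, −1, p(p−1), p(p−1)(2p−1)/6, −p(p−1)/2, −p(p+1)(p−1)/3); row (1²1) = (1, p−1, p(p−2), −p(p−1)/2, −p(p−1)/2, 0); row (111) = (1, 2p−1, −3p, p(εp+5)/6, −p(εp−1)/2, p(εp−1)/3); row (12) = (1, −1, −p, −p(εp−1)/6, p(εp+1)/2, −p(εp−1)/3); row (3) = (1, −p−1, 0, p(εp−1)/6, −p(εp−1)/2, p(εp+2)/3); here ε = +1 if p ≡ 1 (mod 3) and ε = −1 if p ≡ 2 (mod 3). -/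

import Mathlib

open scoped Classical
noncomputable section

/-- The twisted `GL₂`-action on binary cubic forms `f = (a,b,c,d) ↔ ax³+bx²y+cxy²+dy³`:
`(γ·f)(x,y) = det(γ)⁻¹ · f((x,y)γ)`, written out on coefficients. -/
def matAct {R : Type*} [CommRing R] (γ : Matrix (Fin 2) (Fin 2) R) (f : Fin 4 → R) :
    Fin 4 → R :=
  let p := γ 0 0
  let q := γ 1 0
  let r := γ 0 1
  let s := γ 1 1
  fun i => Ring.inverse γ.det *
    ![f 0 * p ^ 3 + f 1 * p ^ 2 * r + f 2 * p * r ^ 2 + f 3 * r ^ 3,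
      3 * f 0 * p ^ 2 * q + f 1 * (p ^ 2 * s + 2 * p * q * r) +
        f 2 * (q * r ^ 2 + 2 * p * r * s) + 3 * f 3 * r ^ 2 * s,
      3 * f 0 * p * q ^ 2 + f 1 * (2 * p * q * s + q ^ 2 * r) +
        f 2 * (p * s ^ 2 + 2 * q * r * s) + 3 * f 3 * r * s ^ 2,
      f 0 * q ^ 3 + f 1 * q ^ 2 * s + f 2 * q * s ^ 2 + f 3 * s ^ 3] i

/-- The twisted action of the general linear group on binary cubic forms. -/
def glAct {R : Type*} [CommRing R] (γ : Matrix.GeneralLinearGroup (Fin 2) R)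
    (f : Fin 4 → R) : Fin 4 → R :=
  matAct (γ : Matrix (Fin 2) (Fin 2) R) f

/-- The compatible `GL₂`-action on the dual space `V*`, with coordinates `(a*,b*,c*,d*)`
corresponding to the form `a*x³+3b*x²y+3c*xy²+d*y³`; the integral polynomial formulas
are obtained from the twisted action through this correspondence. -/
def matActStar {R : Type*} [CommRing R] (γ : Matrix (Fin 2) (Fin 2) R) (g : Fin 4 → R) :
    Fin 4 → R :=
  let p := γ 0 0
  let q := γ 1 0
  let r := γ 0 1
  let s := γ 1 1
  fun i => Ring.inverse γ.det *
    ![g 0 * p ^ 3 + 3 * g 1 * p ^ 2 * r + 3 * g 2 * p * r ^ 2 + g 3 * r ^ 3,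
      g 0 * p ^ 2 * q + g 1 * (p ^ 2 * s + 2 * p * q * r) +
        g 2 * (q * r ^ 2 + 2 * p * r * s) + g 3 * r ^ 2 * s,
      g 0 * p * q ^ 2 + g 1 * (2 * p * q * s + q ^ 2 * r) +
        g 2 * (p * s ^ 2 + 2 * q * r * s) + g 3 * r * s ^ 2,
      g 0 * q ^ 3 + 3 * g 1 * q ^ 2 * s + 3 * g 2 * q * s ^ 2 + g 3 * s ^ 3] i

/-- The dual `GL₂`-action on `V*`. -/
def glActStar {R : Type*} [CommRing R] (γ : Matrix.GeneralLinearGroup (Fin 2) R)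
    (g : Fin 4 → R) : Fin 4 → R :=
  matActStar (γ : Matrix (Fin 2) (Fin 2) R) g

/-- The duality pairing `[f,g] = d·a* − c·b* + b·c* − a·d*`. -/
def bcfPair {R : Type*} [CommRing R] (f g : Fin 4 → R) : R :=
  f 3 * g 0 - f 2 * g 1 + f 1 * g 2 - f 0 * g 3

/-- The Fourier transform of a function on the space of binary cubic forms over `ℤ/nℤ`:
`φ̂(g) = n⁻⁴ ∑_f e^{2πi[f,g]/n} φ(f)`. -/
def bcfFourier (n : ℕ) (φ : (Fin 4 → ZMod n) → ℂ) (g : Fin 4 → ZMod n) : ℂ :=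
  ((n : ℂ) ^ 4)⁻¹ * ∑' f : Fin 4 → ZMod n,
    Complex.exp (2 * Real.pi * Complex.I * (ZMod.val (bcfPair f g) : ℂ) / (n : ℂ)) * φ f

/-- Evaluation of a binary cubic form. -/
def bcfEval {R : Type*} [CommRing R] (f : Fin 4 → R) (x y : R) : R :=
  f 0 * x ^ 3 + f 1 * x ^ 2 * y + f 2 * x * y ^ 2 + f 3 * y ^ 3

/-- Coefficients of the product `(u₁x+v₁y)(u₂x+v₂y)(u₃x+v₃y)` of three linear forms. -/
def linProd {R : Type*} [CommRing R] (u₁ v₁ u₂ v₂ u₃ v₃ : R) : Fin 4 → R :=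
  ![u₁ * u₂ * u₃,
    u₁ * u₂ * v₃ + u₁ * v₂ * u₃ + v₁ * u₂ * u₃,
    u₁ * v₂ * v₃ + v₁ * u₂ * v₃ + v₁ * v₂ * u₃,
    v₁ * v₂ * v₃]

/-- Coefficients of the product `(ux+vy)(Ax²+Bxy+Cy²)`. -/
def linQuadProd {R : Type*} [CommRing R] (u v A B C : R) : Fin 4 → R :=
  ![u * A, u * B + v * A, u * C + v * B, v * C]

/-- The six splitting types of a binary cubic form over `𝔽_p`. -/
inductive FpType : Type
  | t111 | t12 | t3 | t121 | t13 | t0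

/-- `HasFpType f τ` : the binary cubic form `f` has splitting type `τ`: it factors into
three pairwise non-proportional linear forms, a linear form times an irreducible
quadratic form, an irreducible cubic form (no nontrivial zero), `ℓ²m` with `ℓ,m`
non-proportional linear forms, `ℓ³` (up to a scalar), or is zero. -/
def HasFpType {R : Type*} [CommRing R] (f : Fin 4 → R) : FpType → Prop
  | FpType.t111 => ∃ u₁ v₁ u₂ v₂ u₃ v₃ : R,
      u₁ * v₂ - u₂ * v₁ ≠ 0 ∧ u₁ * v₃ - u₃ * v₁ ≠ 0 ∧ u₂ * v₃ - u₃ * v₂ ≠ 0 ∧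
      f = linProd u₁ v₁ u₂ v₂ u₃ v₃
  | FpType.t12 => ∃ u v A B C : R, ¬(u = 0 ∧ v = 0) ∧
      (∀ x y : R, ¬(x = 0 ∧ y = 0) → A * x ^ 2 + B * x * y + C * y ^ 2 ≠ 0) ∧
      f = linQuadProd u v A B C
  | FpType.t3 => ∀ x y : R, ¬(x = 0 ∧ y = 0) → bcfEval f x y ≠ 0
  | FpType.t121 => ∃ u₁ v₁ u₂ v₂ : R, u₁ * v₂ - u₂ * v₁ ≠ 0 ∧
      f = linProd u₁ v₁ u₁ v₁ u₂ v₂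
  | FpType.t13 => ∃ u v c : R, c ≠ 0 ∧ ¬(u = 0 ∧ v = 0) ∧
      f = fun i => c * linProd u v u v u v i
  | FpType.t0 => f = 0

/-- The dual type of `g ∈ V*(𝔽_p)`: the splitting type of the associated form
`a*x³+3b*x²y+3c*xy²+d*y³`. -/
def HasDualFpType {R : Type*} [CommRing R] (g : Fin 4 → R) (τ : FpType) : Prop :=
  HasFpType (![g 0, 3 * g 1, 3 * g 2, g 3]) τ

/-- Mori's matrix `M = (m_{στ})` of Fourier-transform coefficients, rows indexed by dual
types `σ`, columns by types `τ`, both in the order `(0),(1³),(1²1),(111),(12),(3)`;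
`ε = ±1` according as `p ≡ ±1 (mod 3)`. -/
def moriEntry (p : ℕ) (σ τ : FpType) : ℚ :=
  let P : ℚ := p
  let e : ℚ := if p % 3 = 1 then 1 else -1
  (1 / P ^ 4) *
    match σ, τ with
    | FpType.t0, FpType.t0 => 1
    | FpType.t0, FpType.t13 => (P + 1) * (P - 1)
    | FpType.t0, FpType.t121 => P * (P + 1) * (P - 1)
    | FpType.t0, FpType.t111 => P * (P + 1) * (P - 1) ^ 2 / 6
    | FpType.t0, FpType.t12 => P * (P + 1) * (P - 1) ^ 2 / 2
    | FpType.t0, FpType.t3 => P * (P + 1) * (P - 1) ^ 2 / 3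
    | FpType.t13, FpType.t0 => 1
    | FpType.t13, FpType.t13 => -1
    | FpType.t13, FpType.t121 => P * (P - 1)
    | FpType.t13, FpType.t111 => P * (P - 1) * (2 * P - 1) / 6
    | FpType.t13, FpType.t12 => -(P * (P - 1) / 2)
    | FpType.t13, FpType.t3 => -(P * (P + 1) * (P - 1) / 3)
    | FpType.t121, FpType.t0 => 1
    | FpType.t121, FpType.t13 => P - 1
    | FpType.t121, FpType.t121 => P * (P - 2)
    | FpType.t121, FpType.t111 => -(P * (P - 1) / 2)
    | FpType.t121, FpType.t12 => -(P * (P - 1) / 2)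
    | FpType.t121, FpType.t3 => 0
    | FpType.t111, FpType.t0 => 1
    | FpType.t111, FpType.t13 => 2 * P - 1
    | FpType.t111, FpType.t121 => -(3 * P)
    | FpType.t111, FpType.t111 => P * (e * P + 5) / 6
    | FpType.t111, FpType.t12 => -(P * (e * P - 1) / 2)
    | FpType.t111, FpType.t3 => P * (e * P - 1) / 3
    | FpType.t12, FpType.t0 => 1
    | FpType.t12, FpType.t13 => -1
    | FpType.t12, FpType.t121 => -P
    | FpType.t12, FpType.t111 => -(P * (e * P - 1) / 6)
    | FpType.t12, FpType.t12 => P * (e * P + 1) / 2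
    | FpType.t12, FpType.t3 => -(P * (e * P - 1) / 3)
    | FpType.t3, FpType.t0 => 1
    | FpType.t3, FpType.t13 => -(P + 1)
    | FpType.t3, FpType.t121 => 0
    | FpType.t3, FpType.t111 => P * (e * P - 1) / 6
    | FpType.t3, FpType.t12 => -(P * (e * P - 1) / 2)
    | FpType.t3, FpType.t3 => P * (e * P + 2) / 3

section Algebra

variable {K : Type*} [Field K]

/-- The resultant of two linear forms, which is also the value of `ℓ` at the zero of `m`. -/
def cr (ℓ m : K × K) : K := ℓ.1 * m.2 - m.1 * ℓ.2

/-- The linear form `ℓ` divides the cubic form `f`. -/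
def Root (f : Fin 4 → K) (ℓ : K × K) : Prop := bcfEval f ℓ.2 (-ℓ.1) = 0

/-- Both partial derivatives of `f` vanish at the zero of `ℓ`. -/
def DoubleRoot (f : Fin 4 → K) (ℓ : K × K) : Prop :=
  3 * f 0 * ℓ.2 ^ 2 - 2 * f 1 * ℓ.1 * ℓ.2 + f 2 * ℓ.1 ^ 2 = 0 ∧
    f 1 * ℓ.2 ^ 2 - 2 * f 2 * ℓ.1 * ℓ.2 + 3 * f 3 * ℓ.1 ^ 2 = 0

/-- `f` is a multiple of the cube of `ℓ`. -/
def TripleRoot (f : Fin 4 → K) (ℓ : K × K) : Prop :=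
  3 * ℓ.2 * f 0 = ℓ.1 * f 1 ∧ ℓ.2 * f 1 = ℓ.1 * f 2 ∧ ℓ.2 * f 2 = 3 * ℓ.1 * f 3

/-- The symmetric trilinear form attached to an element of the dual space. -/
def tri (g : Fin 4 → K) (ℓ m n : K × K) : K :=
  bcfPair (linProd ℓ.1 ℓ.2 m.1 m.2 n.1 n.2) g

/-- The cubic form `a*x³+3b*x²y+3c*xy²+d*y³` associated with an element of the dual space. -/
def assocForm (g : Fin 4 → K) : Fin 4 → K := ![g 0, 3 * g 1, 3 * g 2, g 3]

lemma ne_zero_cases {ℓ : K × K} (h : ℓ ≠ 0) : ℓ.1 ≠ 0 ∨ ℓ.2 ≠ 0 := by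
  by_contra! H
  exact h (Prod.ext H.1 H.2)

lemma cr_self (ℓ : K × K) : cr ℓ ℓ = 0 := by simp [cr]

lemma cr_comm (ℓ m : K × K) : cr ℓ m = - cr m ℓ := by simp only [cr]; ring

lemma exists_smul_of_cr_eq_zero {ℓ m : K × K} (hℓ : ℓ ≠ 0) (h : cr ℓ m = 0) :
    ∃ c : K, m = c • ℓ := by
  simp only [cr] at h
  rcases ne_zero_cases hℓ with h0 | h0
  · refine ⟨m.1 / ℓ.1, Prod.ext ?_ ?_⟩ <;> simp only [Prod.smul_fst, Prod.smul_snd, smul_eq_mul]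
    · field_simp
    · field_simp; linear_combination h
  · refine ⟨m.2 / ℓ.2, Prod.ext ?_ ?_⟩ <;> simp only [Prod.smul_fst, Prod.smul_snd, smul_eq_mul]
    · field_simp; linear_combination -h
    · field_simp

lemma exists_combination {ℓ m : K × K} (h : cr ℓ m ≠ 0) (n : K × K) :
    ∃ a b : K, n = a • ℓ + b • m := by
  refine ⟨cr n m / cr ℓ m, cr ℓ n / cr ℓ m, ?_⟩
  simp only [cr] at *
  apply Prod.ext <;> simp only [Prod.smul_fst, Prod.smul_snd, smul_eq_mul, Prod.fst_add,
    Prod.snd_add] <;>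
    rw [div_mul_eq_mul_div, div_mul_eq_mul_div, ← add_div, eq_div_iff h] <;> ring

lemma cr_combination (ℓ m : K × K) (a b c d : K) :
    cr (a • ℓ + b • m) (c • ℓ + d • m) = (a * d - b * c) * cr ℓ m := by
  simp [cr]; ring

lemma fst_or_snd_ne_zero_of_cr_ne_zero {ℓ m : K × K} (h : cr ℓ m ≠ 0) : ℓ ≠ 0 ∧ m ≠ 0 := by
  constructor <;> rintro rfl <;> simp [cr] at h

lemma root_iff_exists {ℓ : K × K} (hℓ : ℓ ≠ 0) (f : Fin 4 → K) :
    Root f ℓ ↔ ∃ L : Fin 3 → K, linQuadProd ℓ.1 ℓ.2 (L 0) (L 1) (L 2) = f := by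
  constructor
  · intro h
    simp only [Root, bcfEval] at h
    rcases ne_zero_cases hℓ with h0 | h0
    · refine ⟨![f 0 / ℓ.1, (f 1 - ℓ.2 * (f 0 / ℓ.1)) / ℓ.1,
        (f 2 - ℓ.2 * ((f 1 - ℓ.2 * (f 0 / ℓ.1)) / ℓ.1)) / ℓ.1], ?_⟩
      ext i
      fin_cases i <;> simp [linQuadProd] <;> field_simp
      · ring
      · ring
      · linear_combination h
    · refine ⟨![(f 1 - ℓ.1 * ((f 2 - ℓ.1 * (f 3 / ℓ.2)) / ℓ.2)) / ℓ.2,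
        (f 2 - ℓ.1 * (f 3 / ℓ.2)) / ℓ.2, f 3 / ℓ.2], ?_⟩
      ext i
      fin_cases i <;> simp [linQuadProd] <;> field_simp
      · linear_combination -h
      · ring
      · ring
  · rintro ⟨L, rfl⟩
    simp [Root, bcfEval, linQuadProd]
    ring

lemma linQuadProd_eq_zero {ℓ : K × K} (hℓ : ℓ ≠ 0) {A B C : K}
    (h : linQuadProd ℓ.1 ℓ.2 A B C = 0) : A = 0 ∧ B = 0 ∧ C = 0 := by
  have h0 := congrFun h 0
  have h1 := congrFun h 1
  have h2 := congrFun h 2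
  have h3 := congrFun h 3
  simp [linQuadProd] at h0 h1 h2 h3
  rcases ne_zero_cases hℓ with h' | h'
  · simp_all
  · simp_all

lemma exists_of_quad_root {m : K × K} (hm : m ≠ 0) {A B C : K}
    (h : A * m.2 ^ 2 - B * m.2 * m.1 + C * m.1 ^ 2 = 0) :
    ∃ u v : K, A = m.1 * u ∧ B = m.1 * v + m.2 * u ∧ C = m.2 * v := by
  rcases ne_zero_cases hm with h0 | h0
  · refine ⟨A / m.1, (B - m.2 * (A / m.1)) / m.1, ?_, ?_, ?_⟩ <;> field_simp
    · ring
    · linear_combination h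
  · refine ⟨(B - m.1 * (C / m.2)) / m.2, C / m.2, ?_, ?_, ?_⟩ <;> field_simp
    · linear_combination h
    · ring

lemma root_linProd {ℓ : K × K} (a b c : K × K) :
    Root (linProd a.1 a.2 b.1 b.2 c.1 c.2) ℓ ↔ cr a ℓ * cr b ℓ * cr c ℓ = 0 := by
  have key : bcfEval (linProd a.1 a.2 b.1 b.2 c.1 c.2) ℓ.2 (-ℓ.1) =
      cr a ℓ * cr b ℓ * cr c ℓ := by
    simp [bcfEval, linProd, cr]
    ring
  rw [Root, key]

lemma root_pair_iff_exists {ℓ m : K × K} (h : cr ℓ m ≠ 0) (f : Fin 4 → K) :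
    (Root f ℓ ∧ Root f m) ↔
      ∃ L : Fin 2 → K, linProd ℓ.1 ℓ.2 m.1 m.2 (L 0) (L 1) = f := by
  obtain ⟨hℓ, hm⟩ := fst_or_snd_ne_zero_of_cr_ne_zero h
  constructor
  · rintro ⟨h1, h2⟩
    obtain ⟨Q, rfl⟩ := (root_iff_exists hℓ f).1 h1
    have h3 : cr ℓ m * (Q 0 * m.2 ^ 2 - Q 1 * m.2 * m.1 + Q 2 * m.1 ^ 2) = 0 := by
      simp [Root, bcfEval, linQuadProd] at h2
      simp only [cr]
      linear_combination h2
    obtain ⟨u, v, hA, hB, hC⟩ := exists_of_quad_root hm ((mul_eq_zero.1 h3).resolve_left h)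
    refine ⟨![u, v], ?_⟩
    ext i
    fin_cases i <;> simp [linQuadProd, linProd, hA, hB, hC] <;> ring
  · rintro ⟨L, rfl⟩
    constructor
    · exact (root_linProd ℓ m (L 0, L 1)).2 (by simp [cr_self])
    · exact (root_linProd ℓ m (L 0, L 1)).2 (by simp [cr_self])

lemma linProd_eq_zero {ℓ m n : K × K} (hℓ : ℓ ≠ 0) (hm : m ≠ 0)
    (h : linProd ℓ.1 ℓ.2 m.1 m.2 n.1 n.2 = 0) : n = 0 := by
  have key : linProd ℓ.1 ℓ.2 m.1 m.2 n.1 n.2 =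
      linQuadProd ℓ.1 ℓ.2 (m.1 * n.1) (m.1 * n.2 + m.2 * n.1) (m.2 * n.2) := by
    ext i
    fin_cases i <;> simp [linQuadProd, linProd] <;> ring
  obtain ⟨h0, h1, h2⟩ := linQuadProd_eq_zero hℓ (key ▸ h)
  rcases ne_zero_cases hm with h' | h'
  · have hn : n.1 = 0 := by simpa [h'] using h0
    refine Prod.ext hn ?_
    simpa [hn, h'] using h1
  · have hn : n.2 = 0 := by simpa [h'] using h2
    refine Prod.ext ?_ hn
    simpa [hn, h'] using h1

lemma DoubleRoot.root (h3 : (3 : K) ≠ 0) {f : Fin 4 → K} {ℓ : K × K} (h : DoubleRoot f ℓ) :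
    Root f ℓ := by
  obtain ⟨h1, h2⟩ := h
  have : 3 * bcfEval f ℓ.2 (-ℓ.1) = 0 := by
    simp only [bcfEval]
    linear_combination ℓ.2 * h1 - ℓ.1 * h2
  exact (mul_eq_zero.1 this).resolve_left h3

lemma TripleRoot.doubleRoot {f : Fin 4 → K} {ℓ : K × K} (h : TripleRoot f ℓ) :
    DoubleRoot f ℓ := by
  obtain ⟨h1, h2, h3⟩ := h
  constructor
  · linear_combination ℓ.2 * h1 - ℓ.1 * h2
  · linear_combination ℓ.2 * h2 - ℓ.1 * h3

lemma doubleRoot_linQuadProd {ℓ : K × K} (a : K × K) (A B C : K) (ha : cr a ℓ = 0) :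
    DoubleRoot (linQuadProd a.1 a.2 A B C) ℓ ↔
      a = 0 ∨ A * ℓ.2 ^ 2 - B * ℓ.2 * ℓ.1 + C * ℓ.1 ^ 2 = 0 := by
  have e1 : 3 * (linQuadProd a.1 a.2 A B C) 0 * ℓ.2 ^ 2
      - 2 * (linQuadProd a.1 a.2 A B C) 1 * ℓ.1 * ℓ.2 + (linQuadProd a.1 a.2 A B C) 2 * ℓ.1 ^ 2
      = a.1 * (A * ℓ.2 ^ 2 - B * ℓ.2 * ℓ.1 + C * ℓ.1 ^ 2) := by
    simp only [cr] at ha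
    simp [linQuadProd]
    linear_combination (2 * A * ℓ.2 - B * ℓ.1) * ha
  have e2 : (linQuadProd a.1 a.2 A B C) 1 * ℓ.2 ^ 2
      - 2 * (linQuadProd a.1 a.2 A B C) 2 * ℓ.1 * ℓ.2 + 3 * (linQuadProd a.1 a.2 A B C) 3 * ℓ.1 ^ 2
      = a.2 * (A * ℓ.2 ^ 2 - B * ℓ.2 * ℓ.1 + C * ℓ.1 ^ 2) := by
    simp only [cr] at ha
    simp [linQuadProd]
    linear_combination (B * ℓ.2 - 2 * C * ℓ.1) * ha
  rw [DoubleRoot, e1, e2, mul_eq_zero, mul_eq_zero, ← and_or_right, Prod.ext_iff]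
  rfl

lemma linProd_eq_linQuadProd (a b c : K × K) :
    linProd a.1 a.2 b.1 b.2 c.1 c.2 =
      linQuadProd a.1 a.2 (b.1 * c.1) (b.1 * c.2 + b.2 * c.1) (b.2 * c.2) := by
  ext i
  fin_cases i <;> simp [linQuadProd, linProd] <;> ring

lemma doubleRoot_linProd {ℓ : K × K} (a b c : K × K) (ha0 : a ≠ 0) (ha : cr a ℓ = 0) :
    DoubleRoot (linProd a.1 a.2 b.1 b.2 c.1 c.2) ℓ ↔ cr b ℓ * cr c ℓ = 0 := by
  rw [linProd_eq_linQuadProd, doubleRoot_linQuadProd _ _ _ _ ha]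
  simp only [ha0, false_or, cr]
  constructor <;> intro h <;> linear_combination h

lemma doubleRoot_iff_exists (h3 : (3 : K) ≠ 0) {ℓ : K × K} (hℓ : ℓ ≠ 0) (f : Fin 4 → K) :
    DoubleRoot f ℓ ↔ ∃ L : Fin 2 → K, linProd ℓ.1 ℓ.2 ℓ.1 ℓ.2 (L 0) (L 1) = f := by
  constructor
  · intro h
    obtain ⟨Q, rfl⟩ := (root_iff_exists hℓ f).1 (h.root h3)
    obtain ⟨u, v, hA, hB, hC⟩ := exists_of_quad_root hℓ
      (((doubleRoot_linQuadProd ℓ _ _ _ (cr_self ℓ)).1 h).resolve_left hℓ)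
    refine ⟨![u, v], ?_⟩
    ext i
    fin_cases i <;> simp [linQuadProd, linProd, hA, hB, hC] <;> ring
  · rintro ⟨L, rfl⟩
    exact (doubleRoot_linProd ℓ ℓ (L 0, L 1) hℓ (cr_self ℓ)).2 (by simp [cr_self])

lemma tripleRoot_linProd {ℓ : K × K} (hℓ : ℓ ≠ 0) (c : K × K) :
    TripleRoot (linProd ℓ.1 ℓ.2 ℓ.1 ℓ.2 c.1 c.2) ℓ ↔ cr ℓ c = 0 := by
  simp only [TripleRoot, linProd, cr]
  simp
  constructor
  · rintro ⟨h0, h1, h2⟩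
    rcases ne_zero_cases hℓ with h' | h'
    · have : ℓ.1 ^ 2 * (ℓ.1 * c.2 - c.1 * ℓ.2) = 0 := by linear_combination -h0
      simpa [h'] using this
    · have : ℓ.2 ^ 2 * (ℓ.1 * c.2 - c.1 * ℓ.2) = 0 := by linear_combination -h2
      simpa [h'] using this
  · intro h
    refine ⟨?_, ?_, ?_⟩
    · linear_combination -ℓ.1 ^ 2 * h
    · linear_combination -ℓ.1 * ℓ.2 * h
    · linear_combination -ℓ.2 ^ 2 * h

lemma tripleRoot_iff_exists (h3 : (3 : K) ≠ 0) {ℓ : K × K} (hℓ : ℓ ≠ 0) (f : Fin 4 → K) :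
    TripleRoot f ℓ ↔
      ∃ L : Fin 1 → K, linProd ℓ.1 ℓ.2 ℓ.1 ℓ.2 (L 0 * ℓ.1) (L 0 * ℓ.2) = f := by
  constructor
  · intro h
    obtain ⟨L, rfl⟩ := (doubleRoot_iff_exists h3 hℓ f).1 h.doubleRoot
    obtain ⟨c, hc⟩ := exists_smul_of_cr_eq_zero hℓ
      ((tripleRoot_linProd hℓ (L 0, L 1)).1 h)
    refine ⟨![c], ?_⟩
    have h0 : L 0 = c * ℓ.1 := congrArg Prod.fst hc
    have h1 : L 1 = c * ℓ.2 := congrArg Prod.snd hc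
    simp [h0, h1]
  · rintro ⟨L, rfl⟩
    exact (tripleRoot_linProd hℓ (L 0 * ℓ.1, L 0 * ℓ.2)).2 (by simp [cr]; ring)

lemma root_assocForm (g : Fin 4 → K) (ℓ : K × K) :
    Root (assocForm g) ℓ ↔ tri g ℓ ℓ ℓ = 0 := by
  simp only [Root, bcfEval, assocForm, tri, bcfPair, linProd]
  simp
  constructor <;> intro h <;> linear_combination h

lemma doubleRoot_assocForm (h3 : (3 : K) ≠ 0) (g : Fin 4 → K) (ℓ : K × K) :
    DoubleRoot (assocForm g) ℓ ↔ ∀ n, tri g ℓ ℓ n = 0 := by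
  simp only [DoubleRoot, assocForm, tri, bcfPair, linProd]
  simp
  constructor
  · rintro ⟨h1, h2⟩ x y
    refine mul_left_cancel₀ h3 ?_
    linear_combination y * h1 - x * h2
  · intro h
    have h1 := h 0 1
    have h2 := h 1 0
    constructor
    · linear_combination 3 * h1
    · linear_combination -3 * h2

lemma tripleRoot_assocForm (h3 : (3 : K) ≠ 0) (g : Fin 4 → K) (ℓ : K × K) :
    TripleRoot (assocForm g) ℓ ↔
      ∀ L : Fin 3 → K, bcfPair (linQuadProd ℓ.1 ℓ.2 (L 0) (L 1) (L 2)) g = 0 := by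
  simp only [TripleRoot, assocForm, bcfPair, linQuadProd]
  simp
  constructor
  · rintro ⟨h1, h2, h4⟩ L
    refine mul_left_cancel₀ h3 ?_
    linear_combination L 2 * h1 - L 1 * h2 + L 0 * h4
  · intro h
    have h1 := h ![0, 0, 1]
    have h2 := h ![0, 1, 0]
    have h4 := h ![1, 0, 0]
    simp at h1 h2 h4
    refine ⟨?_, ?_, ?_⟩
    · linear_combination 3 * h1
    · linear_combination -3 * h2
    · linear_combination 3 * h4

end Algebra

section Counting

variable {K : Type*} [Field K]

lemma linProd_swap_left (a b c : K × K) :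
    linProd a.1 a.2 b.1 b.2 c.1 c.2 = linProd b.1 b.2 a.1 a.2 c.1 c.2 := by
  simp only [linProd]
  congr! 1
  · ring
  · congr! 1
    · ring
    · congr! 1
      · ring
      · congr! 1
        ring

lemma linProd_swap_right (a b c : K × K) :
    linProd a.1 a.2 b.1 b.2 c.1 c.2 = linProd a.1 a.2 c.1 c.2 b.1 b.2 := by
  ext i
  fin_cases i <;> simp [linProd] <;> ring

lemma cr_eq_zero_of_common {a b ℓ : K × K} (hℓ : ℓ ≠ 0) (ha : cr a ℓ = 0) (hb : cr b ℓ = 0) :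
    cr a b = 0 := by
  rw [cr_comm, neg_eq_zero] at ha hb
  obtain ⟨c, rfl⟩ := exists_smul_of_cr_eq_zero hℓ ha
  obtain ⟨d, rfl⟩ := exists_smul_of_cr_eq_zero hℓ hb
  simp [cr]
  ring

lemma TripleRoot.of_smul {f : Fin 4 → K} {ℓ : K × K} {c : K} (hc : c ≠ 0)
    (h : TripleRoot f (c • ℓ)) : TripleRoot f ℓ := by
  obtain ⟨h0, h1, h2⟩ := h
  simp only [Prod.smul_fst, Prod.smul_snd, smul_eq_mul] at h0 h1 h2
  refine ⟨mul_left_cancel₀ hc ?_, mul_left_cancel₀ hc ?_, mul_left_cancel₀ hc ?_⟩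
  · linear_combination h0
  · linear_combination h1
  · linear_combination h2

/-- Normal forms for the splitting types with a rational linear factor. -/
lemma exists_linProd_of_t111 {f : Fin 4 → K} (h : HasFpType f FpType.t111) :
    ∃ a b c : K × K, cr a b ≠ 0 ∧ cr a c ≠ 0 ∧ cr b c ≠ 0 ∧
      f = linProd a.1 a.2 b.1 b.2 c.1 c.2 := by
  obtain ⟨u₁, v₁, u₂, v₂, u₃, v₃, h1, h2, h3, h4⟩ := h
  exact ⟨(u₁, v₁), (u₂, v₂), (u₃, v₃), h1, h2, h3, h4⟩

lemma exists_linProd_of_t121 {f : Fin 4 → K} (h : HasFpType f FpType.t121) :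
    ∃ a b : K × K, cr a b ≠ 0 ∧ f = linProd a.1 a.2 a.1 a.2 b.1 b.2 := by
  obtain ⟨u₁, v₁, u₂, v₂, h1, h2⟩ := h
  exact ⟨(u₁, v₁), (u₂, v₂), h1, h2⟩

lemma exists_linProd_of_t13 {f : Fin 4 → K} (h : HasFpType f FpType.t13) :
    ∃ (a : K × K) (c : K), a ≠ 0 ∧ c ≠ 0 ∧
      f = linProd a.1 a.2 a.1 a.2 (c • a).1 (c • a).2 := by
  obtain ⟨u, v, c, hc, h1, rfl⟩ := h
  refine ⟨(u, v), c, fun h => h1 (by simpa using h), hc, ?_⟩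
  ext i
  fin_cases i <;> simp [linProd] <;> ring

lemma exists_linQuadProd_of_t12 {f : Fin 4 → K} (h : HasFpType f FpType.t12) :
    ∃ (a : K × K) (A B C : K), a ≠ 0 ∧
      (∀ ℓ : K × K, ℓ ≠ 0 → A * ℓ.2 ^ 2 - B * ℓ.2 * ℓ.1 + C * ℓ.1 ^ 2 ≠ 0) ∧
      f = linQuadProd a.1 a.2 A B C := by
  obtain ⟨u, v, A, B, C, h1, h2, h3⟩ := h
  refine ⟨(u, v), A, B, C, fun h => h1 (by simpa using h), fun ℓ hℓ h => ?_, h3⟩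
  refine h2 ℓ.2 (-ℓ.1) (fun h' => hℓ (Prod.ext (neg_eq_zero.1 h'.2) h'.1)) ?_
  linear_combination h

lemma not_root_of_t3 {f : Fin 4 → K} (h : HasFpType f FpType.t3) {ℓ : K × K} (hℓ : ℓ ≠ 0) :
    ¬ Root f ℓ :=
  h ℓ.2 (-ℓ.1) fun h' => hℓ (Prod.ext (neg_eq_zero.1 h'.2) h'.1)

lemma root_t13 {a ℓ : K × K} {c : K} (hc : c ≠ 0) :
    Root (linProd a.1 a.2 a.1 a.2 (c • a).1 (c • a).2) ℓ ↔ cr a ℓ = 0 := by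
  have : cr (c • a) ℓ = c * cr a ℓ := by simp [cr]; ring
  rw [root_linProd, this]
  simp [hc]

lemma tripleRoot_t13 {a ℓ : K × K} {c : K} (h : cr a ℓ = 0) :
    TripleRoot (linProd a.1 a.2 a.1 a.2 (c • a).1 (c • a).2) ℓ := by
  simp only [cr] at h
  refine ⟨?_, ?_, ?_⟩ <;> simp [linProd]
  · linear_combination 3 * c * a.1 ^ 2 * h
  · linear_combination 3 * c * a.1 * a.2 * h
  · linear_combination 3 * c * a.2 ^ 2 * h

lemma root_linQuadProd {a ℓ : K × K} {A B C : K}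
    (hQ : A * ℓ.2 ^ 2 - B * ℓ.2 * ℓ.1 + C * ℓ.1 ^ 2 ≠ 0) :
    Root (linQuadProd a.1 a.2 A B C) ℓ ↔ cr a ℓ = 0 := by
  have key : bcfEval (linQuadProd a.1 a.2 A B C) ℓ.2 (-ℓ.1) =
      cr a ℓ * (A * ℓ.2 ^ 2 - B * ℓ.2 * ℓ.1 + C * ℓ.1 ^ 2) := by
    simp [bcfEval, linQuadProd, cr]
    ring
  rw [Root, key]
  simp [hQ]

lemma doubleRoot_t121 (h3 : (3 : K) ≠ 0) {a b ℓ : K × K} (hab : cr a b ≠ 0) :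
    DoubleRoot (linProd a.1 a.2 a.1 a.2 b.1 b.2) ℓ ↔ cr a ℓ = 0 := by
  obtain ⟨ha, hb⟩ := fst_or_snd_ne_zero_of_cr_ne_zero hab
  constructor
  · intro h
    have h1 := (root_linProd a a b).1 (h.root h3)
    rcases mul_eq_zero.1 h1 with h1 | h1
    · simpa using h1
    · rw [linProd_swap_right, linProd_swap_left, doubleRoot_linProd b a a hb h1] at h
      simpa using h
  · intro h
    rw [doubleRoot_linProd a a b ha h, h, zero_mul]

lemma not_tripleRoot_t121 (h3 : (3 : K) ≠ 0) {a b ℓ : K × K} (hℓ : ℓ ≠ 0)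
    (hab : cr a b ≠ 0) : ¬ TripleRoot (linProd a.1 a.2 a.1 a.2 b.1 b.2) ℓ := by
  intro h
  obtain ⟨ha, hb⟩ := fst_or_snd_ne_zero_of_cr_ne_zero hab
  obtain ⟨c, rfl⟩ := exists_smul_of_cr_eq_zero ha ((doubleRoot_t121 h3 hab).1 h.doubleRoot)
  have hc : c ≠ 0 := by rintro rfl; simp at hℓ
  exact hab ((tripleRoot_linProd ha b).1 (h.of_smul hc))

lemma not_doubleRoot_t111 (h3 : (3 : K) ≠ 0) {a b c ℓ : K × K} (hℓ : ℓ ≠ 0)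
    (hab : cr a b ≠ 0) (hac : cr a c ≠ 0) (hbc : cr b c ≠ 0) :
    ¬ DoubleRoot (linProd a.1 a.2 b.1 b.2 c.1 c.2) ℓ := by
  have key : ∀ a b c : K × K, cr a b ≠ 0 → cr a c ≠ 0 → cr a ℓ = 0 →
      ¬ DoubleRoot (linProd a.1 a.2 b.1 b.2 c.1 c.2) ℓ := by
    intro a b c hab hac h0 h
    rw [doubleRoot_linProd a b c (fst_or_snd_ne_zero_of_cr_ne_zero hab).1 h0] at h
    rcases mul_eq_zero.1 h with h | h
    · exact hab (cr_eq_zero_of_common hℓ h0 h)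
    · exact hac (cr_eq_zero_of_common hℓ h0 h)
  have hba : cr b a ≠ 0 := by rw [cr_comm]; simpa using hab
  have hca : cr c a ≠ 0 := by rw [cr_comm]; simpa using hac
  have hcb : cr c b ≠ 0 := by rw [cr_comm]; simpa using hbc
  intro h
  have h1 := (root_linProd a b c).1 (h.root h3)
  rcases mul_eq_zero.1 h1 with h1 | h1
  · rcases mul_eq_zero.1 h1 with h1 | h1
    · exact key a b c hab hac h1 h
    · exact key b a c hba hbc h1 (linProd_swap_left a b c ▸ h)
  · rw [linProd_swap_right, linProd_swap_left] at h
    exact key c a b hca hcb h1 h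

lemma not_doubleRoot_t12 (h3 : (3 : K) ≠ 0) {a ℓ : K × K} {A B C : K} (ha : a ≠ 0)
    (hQ : A * ℓ.2 ^ 2 - B * ℓ.2 * ℓ.1 + C * ℓ.1 ^ 2 ≠ 0) :
    ¬ DoubleRoot (linQuadProd a.1 a.2 A B C) ℓ := by
  intro h
  have h1 := (root_linQuadProd hQ).1 (h.root h3)
  exact ((doubleRoot_linQuadProd a A B C h1).1 h).elim ha hQ

lemma exists_hasFpType (f : Fin 4 → K) : ∃ τ, HasFpType f τ := by
  by_cases hf : f = 0
  · exact ⟨FpType.t0, hf⟩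
  by_cases h1 : ∃ ℓ : K × K, ℓ ≠ 0 ∧ Root f ℓ
  swap
  · refine ⟨FpType.t3, fun x y hxy h => h1 ⟨(-y, x), fun h' => hxy ?_, ?_⟩⟩
    · simpa [and_comm] using h'
    · simpa [Root] using h
  obtain ⟨ℓ, hℓ, h1⟩ := h1
  obtain ⟨Q, rfl⟩ := (root_iff_exists hℓ f).1 h1
  by_cases h2 : ∃ m : K × K, m ≠ 0 ∧ Q 0 * m.2 ^ 2 - Q 1 * m.2 * m.1 + Q 2 * m.1 ^ 2 = 0
  swap
  · refine ⟨FpType.t12, ℓ.1, ℓ.2, Q 0, Q 1, Q 2, fun h => hℓ (Prod.ext h.1 h.2),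
      fun x y hxy h => h2 ⟨(-y, x), fun h' => hxy ?_, ?_⟩, rfl⟩
    · simpa [and_comm] using h'
    · simpa using h
  obtain ⟨m, hm, h2⟩ := h2
  obtain ⟨u, v, hA, hB, hC⟩ := exists_of_quad_root hm h2
  obtain ⟨n, hn⟩ : ∃ n : K × K, n = (u, v) := ⟨_, rfl⟩
  have hu : u = n.1 := by rw [hn]
  have hv : v = n.2 := by rw [hn]
  subst hu hv
  rw [hA, hB, hC, ← linProd_eq_linQuadProd ℓ m n] at hf ⊢
  have square : ∀ a b : K × K, linProd a.1 a.2 a.1 a.2 b.1 b.2 ≠ 0 →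
      ∃ τ, HasFpType (linProd a.1 a.2 a.1 a.2 b.1 b.2) τ := by
    intro a b h
    have ha : a ≠ 0 := by
      rintro rfl
      apply h
      ext i
      fin_cases i <;> simp [linProd]
    by_cases hab : cr a b = 0
    · obtain ⟨c, rfl⟩ := exists_smul_of_cr_eq_zero ha hab
      refine ⟨FpType.t13, a.1, a.2, c, ?_, fun h => ha (Prod.ext h.1 h.2), ?_⟩
      · rintro rfl
        apply h
        ext i
        fin_cases i <;> simp [linProd]
      · ext i
        fin_cases i <;> simp [linProd] <;> ring
    · exact ⟨FpType.t121, a.1, a.2, b.1, b.2, hab, rfl⟩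
  have pull : ∀ (a b : K × K) (c : K), linProd a.1 a.2 (c • a).1 (c • a).2 b.1 b.2 =
      linProd a.1 a.2 a.1 a.2 (c • b).1 (c • b).2 := by
    intro a b c
    ext i
    fin_cases i <;> simp [linProd] <;> ring
  by_cases hab : cr ℓ m = 0
  · obtain ⟨c, rfl⟩ := exists_smul_of_cr_eq_zero hℓ hab
    rw [pull] at hf ⊢
    exact square _ _ hf
  by_cases hac : cr ℓ n = 0
  · obtain ⟨c, rfl⟩ := exists_smul_of_cr_eq_zero hℓ hac
    rw [linProd_swap_right, pull] at hf ⊢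
    exact square _ _ hf
  by_cases hbc : cr m n = 0
  · obtain ⟨c, rfl⟩ := exists_smul_of_cr_eq_zero hm hbc
    rw [linProd_swap_left, linProd_swap_right, pull] at hf ⊢
    exact square _ _ hf
  exact ⟨FpType.t111, ℓ.1, ℓ.2, m.1, m.2, n.1, n.2, hab, hac, hbc, rfl⟩

/-- The complex-valued indicator of a proposition. -/
def ind (P : Prop) : ℂ := if P then 1 else 0

lemma ind_true {P : Prop} (h : P) : ind P = 1 := if_pos h

lemma ind_false {P : Prop} (h : ¬ P) : ind P = 0 := if_neg h

lemma ind_and (P Q : Prop) : ind (P ∧ Q) = ind P * ind Q := by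
  by_cases hP : P <;> by_cases hQ : Q <;> simp [ind, hP, hQ]

lemma ind_not (P : Prop) : ind (¬ P) = 1 - ind P := by
  by_cases hP : P <;> simp [ind, hP]

lemma ind_or {P Q : Prop} (h : ¬ (P ∧ Q)) : ind (P ∨ Q) = ind P + ind Q := by
  by_cases hP : P <;> by_cases hQ : Q <;> simp_all [ind]

/-- The nondegenerate splitting types. -/
def FpType.Separable : FpType → Prop
  | FpType.t111 => True
  | FpType.t12 => True
  | FpType.t3 => True
  | _ => False

lemma not_doubleRoot_of_separable (h3 : (3 : K) ≠ 0) {f : Fin 4 → K} {τ : FpType}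
    (h : HasFpType f τ) (hτ : τ.Separable) {ℓ : K × K} (hℓ : ℓ ≠ 0) : ¬ DoubleRoot f ℓ := by
  cases τ with
  | t111 =>
    obtain ⟨a, b, c, hab, hac, hbc, rfl⟩ := exists_linProd_of_t111 h
    exact not_doubleRoot_t111 h3 hℓ hab hac hbc
  | t12 =>
    obtain ⟨a, A, B, C, ha, hQ, rfl⟩ := exists_linQuadProd_of_t12 h
    exact not_doubleRoot_t12 h3 ha (hQ ℓ hℓ)
  | t3 => exact fun h' => not_root_of_t3 h hℓ (h'.root h3)
  | t121 => exact hτ.elim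
  | t13 => exact hτ.elim
  | t0 => exact hτ.elim

variable [Fintype K]

variable (K) in
/-- The nonzero linear forms. -/
def nonzeroForms : Finset (K × K) := Finset.univ.filter (· ≠ 0)

variable (K) in
/-- The number of elements of `K`, as a complex number. -/
def cardC : ℂ := (Fintype.card K : ℂ)

lemma mem_nonzeroForms {ℓ : K × K} : ℓ ∈ nonzeroForms K ↔ ℓ ≠ 0 := by
  simp [nonzeroForms]

lemma sum_nonzeroForms_one : ∑ _ℓ ∈ nonzeroForms K, (1 : ℂ) = cardC K ^ 2 - 1 := by
  have h : nonzeroForms K = Finset.univ.erase 0 := by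
    ext ℓ; simp [nonzeroForms]
  rw [Finset.sum_const, h, Finset.card_erase_of_mem (Finset.mem_univ _), Finset.card_univ,
    Fintype.card_prod, nsmul_eq_mul, mul_one, Nat.cast_sub, cardC]
  · push_cast; ring
  · exact Nat.one_le_iff_ne_zero.2 (Nat.mul_ne_zero Fintype.card_ne_zero Fintype.card_ne_zero)

lemma sum_line {a : K × K} (ha : a ≠ 0) :
    ∑ ℓ ∈ nonzeroForms K, ind (cr a ℓ = 0) = cardC K - 1 := by
  have h : ∑ ℓ ∈ nonzeroForms K, ind (cr a ℓ = 0) =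
      ∑ _c ∈ (Finset.univ : Finset K).erase 0, (1 : ℂ) := by
    simp only [ind]
    rw [← Finset.sum_filter]
    symm
    refine Finset.sum_bij (fun c _ => c • a) ?_ ?_ ?_ ?_
    · intro c hc
      rw [Finset.mem_filter, mem_nonzeroForms]
      refine ⟨smul_ne_zero (by simpa using hc) ha, ?_⟩
      simp [cr]; ring
    · intro c _ d _ h
      exact smul_left_injective K ha h
    · intro ℓ hℓ
      rw [Finset.mem_filter, mem_nonzeroForms] at hℓ
      obtain ⟨c, rfl⟩ := exists_smul_of_cr_eq_zero ha hℓ.2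
      refine ⟨c, ?_, rfl⟩
      simp only [Finset.mem_erase, Finset.mem_univ, and_true]
      rintro rfl
      simp at hℓ
    · intros; rfl
  rw [h, Finset.sum_const, Finset.card_erase_of_mem (Finset.mem_univ _), Finset.card_univ,
    nsmul_eq_mul, mul_one, Nat.cast_sub Fintype.card_pos, cardC]
  simp

/-- The number of roots on the projective line, in terms of the splitting type. -/
def rootTable (q : ℂ) : FpType → ℂ
  | FpType.t0 => q + 1
  | FpType.t13 => 1
  | FpType.t121 => 2
  | FpType.t111 => 3
  | FpType.t12 => 1
  | FpType.t3 => 0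

/-- The number of multiple roots on the projective line, in terms of the splitting type. -/
def doubleTable (q : ℂ) : FpType → ℂ
  | FpType.t0 => q + 1
  | FpType.t13 => 1
  | FpType.t121 => 1
  | FpType.t111 => 0
  | FpType.t12 => 0
  | FpType.t3 => 0

/-- The number of triple roots on the projective line, in terms of the splitting type. -/
def tripleTable (q : ℂ) : FpType → ℂ
  | FpType.t0 => q + 1
  | FpType.t13 => 1
  | FpType.t121 => 0
  | FpType.t111 => 0
  | FpType.t12 => 0
  | FpType.t3 => 0

lemma sum_root {f : Fin 4 → K} {τ : FpType} (h : HasFpType f τ) :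
    ∑ ℓ ∈ nonzeroForms K, ind (Root f ℓ) = (cardC K - 1) * rootTable (cardC K) τ := by
  cases τ with
  | t0 =>
    obtain rfl : f = 0 := h
    rw [Finset.sum_congr rfl fun ℓ _ => ind_true (P := Root 0 ℓ) (by simp [Root, bcfEval]),
      sum_nonzeroForms_one, rootTable]
    ring
  | t13 =>
    obtain ⟨a, c, ha, hc, rfl⟩ := exists_linProd_of_t13 h
    simp only [root_t13 hc, sum_line ha, rootTable, mul_one]
  | t121 =>
    obtain ⟨a, b, hab, rfl⟩ := exists_linProd_of_t121 h
    obtain ⟨ha, hb⟩ := fst_or_snd_ne_zero_of_cr_ne_zero hab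
    have key : ∀ ℓ ∈ nonzeroForms K, ind (Root (linProd a.1 a.2 a.1 a.2 b.1 b.2) ℓ) =
        ind (cr a ℓ = 0) + ind (cr b ℓ = 0) := by
      intro ℓ hℓ
      rw [root_linProd, ← ind_or]
      · simp
      · exact fun h => hab (cr_eq_zero_of_common (mem_nonzeroForms.1 hℓ) h.1 h.2)
    rw [Finset.sum_congr rfl key, Finset.sum_add_distrib, sum_line ha, sum_line hb, rootTable]
    ring
  | t111 =>
    obtain ⟨a, b, c, hab, hac, hbc, rfl⟩ := exists_linProd_of_t111 h
    obtain ⟨ha, hb⟩ := fst_or_snd_ne_zero_of_cr_ne_zero hab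
    obtain ⟨-, hc⟩ := fst_or_snd_ne_zero_of_cr_ne_zero hac
    have key : ∀ ℓ ∈ nonzeroForms K, ind (Root (linProd a.1 a.2 b.1 b.2 c.1 c.2) ℓ) =
        ind (cr a ℓ = 0) + ind (cr b ℓ = 0) + ind (cr c ℓ = 0) := by
      intro ℓ hℓ
      rw [root_linProd, ← ind_or, ← ind_or]
      · simp [or_assoc]
      · rintro ⟨h | h, h'⟩
        · exact hac (cr_eq_zero_of_common (mem_nonzeroForms.1 hℓ) h h')
        · exact hbc (cr_eq_zero_of_common (mem_nonzeroForms.1 hℓ) h h')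
      · exact fun h => hab (cr_eq_zero_of_common (mem_nonzeroForms.1 hℓ) h.1 h.2)
    rw [Finset.sum_congr rfl key, Finset.sum_add_distrib, Finset.sum_add_distrib, sum_line ha,
      sum_line hb, sum_line hc, rootTable]
    ring
  | t12 =>
    obtain ⟨a, A, B, C, ha, hQ, rfl⟩ := exists_linQuadProd_of_t12 h
    rw [Finset.sum_congr rfl fun ℓ hℓ => by rw [root_linQuadProd (hQ ℓ (mem_nonzeroForms.1 hℓ))],
      sum_line ha, rootTable, mul_one]
  | t3 =>
    rw [Finset.sum_congr rfl fun ℓ hℓ => ind_false (not_root_of_t3 h (mem_nonzeroForms.1 hℓ))]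
    simp [rootTable]

lemma sum_doubleRoot (h3 : (3 : K) ≠ 0) {f : Fin 4 → K} {τ : FpType} (h : HasFpType f τ) :
    ∑ ℓ ∈ nonzeroForms K, ind (DoubleRoot f ℓ) =
      (cardC K - 1) * doubleTable (cardC K) τ := by
  have sep : τ.Separable → ∑ ℓ ∈ nonzeroForms K, ind (DoubleRoot f ℓ) = 0 := fun hτ =>
    Finset.sum_eq_zero fun ℓ hℓ =>
      ind_false (not_doubleRoot_of_separable h3 h hτ (mem_nonzeroForms.1 hℓ))
  cases τ with
  | t0 =>
    obtain rfl : f = 0 := h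
    rw [Finset.sum_congr rfl fun ℓ _ => ind_true (P := DoubleRoot 0 ℓ) (by simp [DoubleRoot]),
      sum_nonzeroForms_one, doubleTable]
    ring
  | t13 =>
    obtain ⟨a, c, ha, hc, rfl⟩ := exists_linProd_of_t13 h
    have key : ∀ ℓ, DoubleRoot (linProd a.1 a.2 a.1 a.2 (c • a).1 (c • a).2) ℓ ↔ cr a ℓ = 0 :=
      fun ℓ => ⟨fun h => (root_t13 hc).1 (h.root h3), fun h => (tripleRoot_t13 h).doubleRoot⟩
    simp only [key, sum_line ha, doubleTable, mul_one]
  | t121 =>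
    obtain ⟨a, b, hab, rfl⟩ := exists_linProd_of_t121 h
    simp only [doubleRoot_t121 h3 hab]
    rw [sum_line (fst_or_snd_ne_zero_of_cr_ne_zero hab).1, doubleTable, mul_one]
  | t111 => simpa [doubleTable] using sep trivial
  | t12 => simpa [doubleTable] using sep trivial
  | t3 => simpa [doubleTable] using sep trivial

lemma sum_tripleRoot (h3 : (3 : K) ≠ 0) {f : Fin 4 → K} {τ : FpType} (h : HasFpType f τ) :
    ∑ ℓ ∈ nonzeroForms K, ind (TripleRoot f ℓ) =
      (cardC K - 1) * tripleTable (cardC K) τ := by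
  have sep : τ.Separable → ∑ ℓ ∈ nonzeroForms K, ind (TripleRoot f ℓ) = 0 := fun hτ =>
    Finset.sum_eq_zero fun ℓ hℓ => ind_false fun h' =>
      not_doubleRoot_of_separable h3 h hτ (mem_nonzeroForms.1 hℓ) h'.doubleRoot
  cases τ with
  | t0 =>
    obtain rfl : f = 0 := h
    rw [Finset.sum_congr rfl fun ℓ _ => ind_true (P := TripleRoot 0 ℓ) (by simp [TripleRoot]),
      sum_nonzeroForms_one, tripleTable]
    ring
  | t13 =>
    obtain ⟨a, c, ha, hc, rfl⟩ := exists_linProd_of_t13 h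
    have key : ∀ ℓ, TripleRoot (linProd a.1 a.2 a.1 a.2 (c • a).1 (c • a).2) ℓ ↔ cr a ℓ = 0 :=
      fun ℓ => ⟨fun h => (root_t13 hc).1 (h.doubleRoot.root h3), tripleRoot_t13⟩
    simp only [key, sum_line ha, tripleTable, mul_one]
  | t121 =>
    obtain ⟨a, b, hab, rfl⟩ := exists_linProd_of_t121 h
    rw [Finset.sum_congr rfl fun ℓ hℓ => ind_false
      (not_tripleRoot_t121 h3 (mem_nonzeroForms.1 hℓ) hab)]
    simp [tripleTable]
  | t111 => simpa [tripleTable] using sep trivial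
  | t12 => simpa [tripleTable] using sep trivial
  | t3 => simpa [tripleTable] using sep trivial

lemma cardC_sub_one_ne_zero : cardC K - 1 ≠ 0 := by
  rw [cardC, sub_ne_zero]
  exact_mod_cast Fintype.one_lt_card.ne'

lemma HasFpType.unique (h3 : (3 : K) ≠ 0) {f : Fin 4 → K} {σ τ : FpType}
    (hσ : HasFpType f σ) (hτ : HasFpType f τ) : σ = τ := by
  have q0 : cardC K ≠ 0 := by
    rw [cardC]
    exact_mod_cast Fintype.card_ne_zero
  have q1 : cardC K + 1 ≠ 0 := by
    rw [cardC]
    exact_mod_cast Nat.succ_ne_zero (Fintype.card K)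
  have hn := mul_left_cancel₀ cardC_sub_one_ne_zero ((sum_root hσ).symm.trans (sum_root hτ))
  have hd := mul_left_cancel₀ cardC_sub_one_ne_zero
    ((sum_doubleRoot h3 hσ).symm.trans (sum_doubleRoot h3 hτ))
  have he := mul_left_cancel₀ cardC_sub_one_ne_zero
    ((sum_tripleRoot h3 hσ).symm.trans (sum_tripleRoot h3 hτ))
  cases σ <;> cases τ <;>
    simp [rootTable, doubleTable, tripleTable, q0, q1, q1.symm] at hn hd he ⊢

/-- The number of ordered pairs of independent linear factors. -/
lemma sum_root_pair {f : Fin 4 → K} {τ : FpType} (h : HasFpType f τ) :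
    ∑ ℓ ∈ nonzeroForms K, ∑ m ∈ nonzeroForms K, ind (cr ℓ m ≠ 0 ∧ Root f ℓ ∧ Root f m) =
      (cardC K - 1) ^ 2 * (rootTable (cardC K) τ * (rootTable (cardC K) τ - 1)) := by
  have key : ∀ ℓ ∈ nonzeroForms K, ∀ m ∈ nonzeroForms K,
      ind (cr ℓ m ≠ 0 ∧ Root f ℓ ∧ Root f m) =
        ind (Root f ℓ) * ind (Root f m) - ind (Root f ℓ) * ind (cr ℓ m = 0) := by
    intro ℓ hℓ m hm
    by_cases h1 : cr ℓ m = 0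
    · obtain ⟨c, rfl⟩ := exists_smul_of_cr_eq_zero (mem_nonzeroForms.1 hℓ) h1
      have hc : c ≠ 0 := by
        rintro rfl
        simp [mem_nonzeroForms] at hm
      have e : bcfEval f (c • ℓ).2 (-(c • ℓ).1) = c ^ 3 * bcfEval f ℓ.2 (-ℓ.1) := by
        simp [bcfEval]; ring
      have e' : Root f (c • ℓ) ↔ Root f ℓ := by
        rw [Root, e, Root]; simp [hc]
      rw [ind_false (fun h => h.1 h1), ind_true h1, e']
      by_cases h2 : Root f ℓ <;> simp [ind, h2]
    · rw [ind_and, ind_and, ind_true h1, ind_false h1]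
      ring
  rw [Finset.sum_congr rfl fun ℓ hℓ => Finset.sum_congr rfl (key ℓ hℓ)]
  rw [Finset.sum_congr rfl fun ℓ hℓ => by
    rw [Finset.sum_sub_distrib, ← Finset.mul_sum, ← Finset.mul_sum,
      sum_line (mem_nonzeroForms.1 hℓ), sum_root h, ← mul_sub]]
  rw [← Finset.sum_mul, sum_root h]
  ring

end Counting

section Apolarity

variable {K : Type*} [Field K]

/-- The quadratic form `ℓ * m` is apolar to `g`. -/
def Apolar (g : Fin 4 → K) (ℓ m : K × K) : Prop := ∀ n, tri g ℓ m n = 0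

lemma tri_swap_left (g : Fin 4 → K) (a b c : K × K) : tri g a b c = tri g b a c := by
  rw [tri, linProd_swap_left, tri]

lemma tri_swap_right (g : Fin 4 → K) (a b c : K × K) : tri g a b c = tri g a c b := by
  rw [tri, linProd_swap_right, tri]

lemma tri_combination (g : Fin 4 → K) (ℓ m u w : K × K) (a b : K) :
    tri g ℓ m (a • u + b • w) = a * tri g ℓ m u + b * tri g ℓ m w := by
  simp [tri, bcfPair, linProd]
  ring

lemma Apolar.symm {g : Fin 4 → K} {ℓ m : K × K} (h : Apolar g ℓ m) : Apolar g m ℓ :=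
  fun n => by rw [tri_swap_left, h n]

lemma Apolar.tri_eq {g : Fin 4 → K} {u w : K × K} (h : Apolar g u w) (a b c d x y : K) :
    tri g (a • u + b • w) (c • u + d • w) (x • u + y • w) =
      a * c * x * tri g u u u + b * d * y * tri g w w w := by
  have h1 : ∀ n, tri g w u n = 0 := h.symm
  have h2 : tri g u u w = 0 := by rw [tri_swap_right, h]
  have h4 : tri g w w u = 0 := by rw [tri_swap_right, h1]
  have h5 : ∀ v, tri g (a • u + b • w) v u = a * tri g v u u + b * tri g v u w := by
    intro v
    rw [tri_swap_left, tri_swap_right, tri_combination]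
  have h6 : ∀ v, tri g (a • u + b • w) v w = a * tri g v w u + b * tri g v w w := by
    intro v
    rw [tri_swap_left, tri_swap_right, tri_combination]
  have h7 : ∀ s t, tri g (c • u + d • w) s t = c * tri g s t u + d * tri g s t w := by
    intro s t
    rw [tri_swap_left, tri_swap_right, tri_combination]
  rw [tri_combination, h5, h6, h7, h7, h7, h7, h u, h w, h1 u, h1 w, h2, h4]
  ring

lemma Apolar.tri_left (h3 : (3 : K) ≠ 0) {g : Fin 4 → K} {u w : K × K} (h : Apolar g u w)
    (huw : cr u w ≠ 0) (hg : ∀ v, v ≠ 0 → ¬ DoubleRoot (assocForm g) v) :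
    tri g u u u ≠ 0 := by
  intro h0
  refine hg u (fst_or_snd_ne_zero_of_cr_ne_zero huw).1 ((doubleRoot_assocForm h3 g u).2 ?_)
  intro n
  obtain ⟨a, b, rfl⟩ := exists_combination huw n
  rw [tri_combination, h0, tri_swap_right, h u]
  ring

lemma Apolar.tri_right (h3 : (3 : K) ≠ 0) {g : Fin 4 → K} {u w : K × K} (h : Apolar g u w)
    (huw : cr u w ≠ 0) (hg : ∀ v, v ≠ 0 → ¬ DoubleRoot (assocForm g) v) :
    tri g w w w ≠ 0 :=
  h.symm.tri_left h3 (by rw [cr_comm]; simpa using huw) hg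

lemma Apolar.root_iff {g : Fin 4 → K} {u w : K × K} (h : Apolar g u w) (a b : K) :
    Root (assocForm g) (a • u + b • w) ↔ a ^ 3 * tri g u u u + b ^ 3 * tri g w w w = 0 := by
  rw [root_assocForm, h.tri_eq]
  constructor <;> intro h <;> linear_combination h

lemma not_apolar_t121 (h3 : (3 : K) ≠ 0) {g : Fin 4 → K}
    (hg : HasFpType (assocForm g) FpType.t121) {u w : K × K} (huw : cr u w ≠ 0) :
    ¬ Apolar g u w := by
  intro h
  obtain ⟨a, b, hab, hf⟩ := exists_linProd_of_t121 hg
  obtain ⟨ha, -⟩ := fst_or_snd_ne_zero_of_cr_ne_zero hab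
  have hda : DoubleRoot (assocForm g) a := by
    rw [hf, doubleRoot_t121 h3 hab, cr_self]
  have triple : ∀ v, v ≠ 0 → ¬ TripleRoot (assocForm g) v := fun v hv => by
    rw [hf]
    exact not_tripleRoot_t121 h3 hv hab
  have cube : ∀ u w, cr u w ≠ 0 → Apolar g u w → tri g u u u = 0 → False := by
    intro u w huw h h0
    obtain ⟨hu, -⟩ := fst_or_snd_ne_zero_of_cr_ne_zero huw
    have hd : DoubleRoot (assocForm g) u := by
      rw [doubleRoot_assocForm h3]
      intro n
      obtain ⟨a, b, rfl⟩ := exists_combination huw n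
      rw [tri_combination, h0, tri_swap_right, h u]
      ring
    obtain ⟨c, rfl⟩ := exists_smul_of_cr_eq_zero ha
      ((doubleRoot_t121 h3 hab).1 (hf ▸ hd))
    have hc : c ≠ 0 := by rintro rfl; simp at hu
    refine triple _ hu ?_
    rw [tripleRoot_assocForm h3]
    have main : ∀ x y : K × K, tri g (c • a) x y = 0 := by
      intro x y
      obtain ⟨s, t, rfl⟩ := exists_combination huw x
      rw [tri_swap_right, tri_combination, tri_swap_right,
        (doubleRoot_assocForm h3 g _).1 hd, tri_swap_right, h]
      ring
    intro L
    have e := main (1, 0) (L 0, L 1)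
    have e' := main (0, 1) (0, L 2)
    simp [tri, bcfPair, linProd, linQuadProd] at e e' ⊢
    linear_combination e + e'
  obtain ⟨x, y, hxy⟩ := exists_combination huw a
  have hd := (doubleRoot_assocForm h3 g a).1 hda
  have hu := hd ((1 : K) • u + (0 : K) • w)
  have hw := hd ((0 : K) • u + (1 : K) • w)
  rw [hxy, h.tri_eq] at hu hw
  have hx : x = 0 := by
    by_contra hx
    exact cube u w huw h (by simpa [hx] using hu)
  have hy : y = 0 := by
    by_contra hy
    exact cube w u (by rw [cr_comm]; simpa using huw) h.symm (by simpa [hy] using hw)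
  exact ha (by simp [hxy, hx, hy])

lemma apolar_t13 (h3 : (3 : K) ≠ 0) {g : Fin 4 → K} {a : K × K} {c : K} (ha : a ≠ 0)
    (hc : c ≠ 0) (hg : assocForm g = linProd a.1 a.2 a.1 a.2 (c • a).1 (c • a).2)
    (ℓ m : K × K) : Apolar g ℓ m ↔ cr a ℓ = 0 ∨ cr a m = 0 := by
  have h0 := congrFun hg 0
  have h1 := congrFun hg 1
  have h2 := congrFun hg 2
  have h4 := congrFun hg 3
  simp [assocForm, linProd] at h0 h1 h2 h4
  have key : ∀ n, tri g ℓ m n = c * (cr a ℓ * cr a m * cr a n) := by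
    intro n
    refine mul_left_cancel₀ h3 ?_
    simp only [tri, bcfPair, linProd, cr]
    simp [-mul_eq_mul_left_iff]
    linear_combination (3 * ℓ.2 * m.2 * n.2) * h0
      - (ℓ.1 * m.2 * n.2 + ℓ.2 * m.1 * n.2 + ℓ.2 * m.2 * n.1) * h1
      + (ℓ.1 * m.1 * n.2 + ℓ.1 * m.2 * n.1 + ℓ.2 * m.1 * n.1) * h2
      - (3 * ℓ.1 * m.1 * n.1) * h4
  constructor
  · intro h
    rw [← mul_eq_zero]
    rcases ne_zero_cases ha with h' | h'
    · have := h (0, 1)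
      rw [key] at this
      simpa [hc, cr, h'] using this
    · have := h (1, 0)
      rw [key] at this
      simpa [hc, cr, h'] using this
  · intro h n
    rw [key, mul_eq_zero.2 h]
    ring

lemma combination_eq_zero {u w : K × K} (huw : cr u w ≠ 0) {a b : K}
    (h : a • u + b • w = 0) : b = 0 := by
  have e := cr_combination u w 1 0 a b
  rw [h] at e
  have e' : cr ((1 : K) • u + (0 : K) • w) 0 = 0 := by simp [cr]
  rw [e'] at e
  simpa [huw] using e

lemma cr_smul_combination {u w : K × K} (huw : cr u w ≠ 0) {a b c d : K}
    (h : cr (a • u + b • w) (c • u + d • w) = 0) : a * d = b * c := by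
  rw [cr_combination] at h
  exact sub_eq_zero.1 ((mul_eq_zero.1 h).resolve_right huw)

lemma root_t12_proportional {f : Fin 4 → K} (h : HasFpType f FpType.t12) {ℓ m : K × K}
    (hℓ : ℓ ≠ 0) (hm : m ≠ 0) (h1 : Root f ℓ) (h2 : Root f m) : cr ℓ m = 0 := by
  obtain ⟨a, A, B, C, ha, hQ, rfl⟩ := exists_linQuadProd_of_t12 h
  rw [root_linQuadProd (hQ _ hℓ)] at h1
  rw [root_linQuadProd (hQ _ hm)] at h2
  rw [cr_comm, neg_eq_zero] at h1 h2
  refine cr_eq_zero_of_common ha h1 h2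

/-- If `K` contains a primitive cube root of unity, a sum of two independent cubes cannot have
exactly one root. -/
lemma not_apolar_t12 (h3 : (3 : K) ≠ 0) {ω : K} (hω : ω ^ 3 = 1) (hω1 : ω ≠ 1)
    {g : Fin 4 → K} (hg : HasFpType (assocForm g) FpType.t12) {u w : K × K}
    (huw : cr u w ≠ 0) : ¬ Apolar g u w := by
  intro h
  have hd := fun v hv => not_doubleRoot_of_separable h3 hg trivial (ℓ := v) hv
  have hα := h.tri_left h3 huw hd
  have hβ := h.tri_right h3 huw hd
  obtain ⟨ℓ, A, B, C, hℓ, hQ, hf⟩ := exists_linQuadProd_of_t12 hg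
  have hr : Root (assocForm g) ℓ := by
    rw [hf, root_linQuadProd (hQ ℓ hℓ), cr_self]
  obtain ⟨a, b, rfl⟩ := exists_combination huw ℓ
  rw [h.root_iff] at hr
  have ha : a ≠ 0 := by
    rintro rfl
    have hb : b ≠ 0 := by rintro rfl; simp at hℓ
    simp [hb, hβ] at hr
  have hb : b ≠ 0 := by
    rintro rfl
    simp [ha, hα] at hr
  have hr' : Root (assocForm g) ((ω * a) • u + b • w) := by
    rw [h.root_iff]
    linear_combination hr + a ^ 3 * tri g u u u * hω
  have hω0 : (ω * a) • u + b • w ≠ 0 := by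
    exact fun h0 => hb (combination_eq_zero huw h0)
  have := cr_smul_combination huw (root_t12_proportional hg hℓ hω0 ((h.root_iff a b).2 hr) hr')
  apply hω1
  refine mul_left_cancel₀ (mul_ne_zero ha hb) ?_
  linear_combination -this

/-- If cubing is injective on `K`, a sum of two independent cubes has at most one root. -/
lemma not_apolar_t111 (h3 : (3 : K) ≠ 0) (hcube : Function.Injective fun x : K => x ^ 3)
    {g : Fin 4 → K} (hg : HasFpType (assocForm g) FpType.t111) {u w : K × K}
    (huw : cr u w ≠ 0) : ¬ Apolar g u w := by
  intro h
  have hd := fun v hv => not_doubleRoot_of_separable h3 hg trivial (ℓ := v) hv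
  have hα := h.tri_left h3 huw hd
  have hβ := h.tri_right h3 huw hd
  obtain ⟨x, y, z, hxy, -, -, hf⟩ := exists_linProd_of_t111 hg
  have hx : Root (assocForm g) x := by
    rw [hf, root_linProd, cr_self]; ring
  have hy : Root (assocForm g) y := by
    rw [hf, root_linProd, cr_self]; ring
  obtain ⟨a, b, rfl⟩ := exists_combination huw x
  obtain ⟨c, d, rfl⟩ := exists_combination huw y
  rw [h.root_iff] at hx hy
  have : a * d = b * c := by
    apply hcube
    refine mul_left_cancel₀ (mul_ne_zero hα hβ) ?_
    show _ * (a * d) ^ 3 = _ * (b * c) ^ 3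
    linear_combination d ^ 3 * tri g w w w * hx - b ^ 3 * tri g w w w * hy
  rw [cr_combination, this, sub_self, zero_mul] at hxy
  exact hxy rfl

/-- If cubing is surjective on `K`, a sum of two independent cubes has a root. -/
lemma not_apolar_t3 (h3 : (3 : K) ≠ 0) (hcube : Function.Surjective fun x : K => x ^ 3)
    {g : Fin 4 → K} (hg : HasFpType (assocForm g) FpType.t3) {u w : K × K}
    (huw : cr u w ≠ 0) : ¬ Apolar g u w := by
  intro h
  have hd := fun v hv => not_doubleRoot_of_separable h3 hg trivial (ℓ := v) hv
  have hα := h.tri_left h3 huw hd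
  obtain ⟨a, ha⟩ := hcube (-tri g w w w / tri g u u u)
  simp only at ha
  have hr : Root (assocForm g) (a • u + (1 : K) • w) := by
    rw [h.root_iff, ha]
    field_simp
    ring
  refine not_root_of_t3 hg ?_ hr
  exact fun h0 => one_ne_zero (combination_eq_zero huw h0)

variable [Fintype K]

/-- The number of ordered pairs of independent linear forms whose product is apolar to `g`. -/
def apolarCount (g : Fin 4 → K) : ℕ :=
  ((nonzeroForms K ×ˢ nonzeroForms K).filter fun x => cr x.1 x.2 ≠ 0 ∧ Apolar g x.1 x.2).card

lemma cast_apolarCount (g : Fin 4 → K) :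
    (apolarCount g : ℂ) = ∑ ℓ ∈ nonzeroForms K, ∑ m ∈ nonzeroForms K,
      ind (cr ℓ m ≠ 0 ∧ Apolar g ℓ m) := by
  rw [apolarCount, Finset.card_filter, Nat.cast_sum, Finset.sum_product]
  refine Finset.sum_congr rfl fun ℓ _ => Finset.sum_congr rfl fun m _ => ?_
  simp [ind]

lemma apolarCount_eq_zero {g : Fin 4 → K} (h : ∀ u w, cr u w ≠ 0 → ¬ Apolar g u w) :
    apolarCount g = 0 := by
  rw [apolarCount, Finset.card_eq_zero, Finset.filter_eq_empty_iff]
  exact fun x _ hx => h _ _ hx.1 hx.2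

lemma apolarCount_t0 (h3 : (3 : K) ≠ 0) {g : Fin 4 → K}
    (hg : HasFpType (assocForm g) FpType.t0) :
    (apolarCount g : ℂ) = (cardC K - 1) ^ 2 * (cardC K * (cardC K + 1)) := by
  have h : assocForm g = 0 := hg
  have h0 := congrFun h 0
  have h1 := congrFun h 1
  have h2 := congrFun h 2
  have h4 := congrFun h 3
  simp [assocForm, h3] at h0 h1 h2 h4
  have key : ∀ ℓ m : K × K, ind (cr ℓ m ≠ 0 ∧ Apolar g ℓ m) = 1 - ind (cr ℓ m = 0) := by
    intro ℓ m
    rw [ind_and, ind_true (P := Apolar g ℓ m), mul_one, ← ind_not]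
    intro n
    simp [tri, bcfPair, h0, h1, h2, h4]
  simp only [cast_apolarCount, key, Finset.sum_sub_distrib, sum_nonzeroForms_one]
  rw [Finset.sum_congr rfl fun ℓ hℓ => sum_line (mem_nonzeroForms.1 hℓ)]
  have := sum_nonzeroForms_one (K := K)
  rw [Finset.sum_const, nsmul_eq_mul, mul_one] at this
  rw [Finset.sum_const, Finset.sum_const, nsmul_eq_mul, nsmul_eq_mul, this]
  ring

lemma apolarCount_t13 (h3 : (3 : K) ≠ 0) {g : Fin 4 → K}
    (hg : HasFpType (assocForm g) FpType.t13) :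
    (apolarCount g : ℂ) = (cardC K - 1) ^ 2 * (2 * cardC K) := by
  obtain ⟨a, c, ha, hc, hf⟩ := exists_linProd_of_t13 hg
  have key : ∀ ℓ ∈ nonzeroForms K, ∀ m ∈ nonzeroForms K,
      ind (cr ℓ m ≠ 0 ∧ Apolar g ℓ m) =
        ind (cr a ℓ = 0) * (1 - ind (cr a m = 0)) +
          (1 - ind (cr a ℓ = 0)) * ind (cr a m = 0) := by
    intro ℓ hℓ m hm
    rw [apolar_t13 h3 ha hc hf]
    rw [mem_nonzeroForms] at hℓ hm
    by_cases h1 : cr a ℓ = 0 <;> by_cases h2 : cr a m = 0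
    · rw [ind_true h1, ind_true h2, ind_false]
      · ring
      · rintro ⟨h, -⟩
        rw [cr_comm, neg_eq_zero] at h1 h2
        exact h (cr_eq_zero_of_common ha h1 h2)
    · rw [ind_true h1, ind_false h2, ind_true]
      · ring
      · refine ⟨fun h => h2 ?_, Or.inl h1⟩
        rw [cr_comm, neg_eq_zero] at h
        exact cr_eq_zero_of_common hℓ h1 h
    · rw [ind_false h1, ind_true h2, ind_true]
      · ring
      · refine ⟨fun h => h1 ?_, Or.inr h2⟩
        exact cr_eq_zero_of_common hm h2 h
    · rw [ind_false h1, ind_false h2, ind_false]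
      · ring
      · rintro ⟨-, h | h⟩
        exacts [h1 h, h2 h]
  rw [cast_apolarCount, Finset.sum_congr rfl fun ℓ hℓ => Finset.sum_congr rfl (key ℓ hℓ)]
  simp only [Finset.sum_add_distrib, ← Finset.mul_sum, Finset.sum_sub_distrib, sum_line ha,
    sum_nonzeroForms_one, ← Finset.sum_mul]
  ring

lemma apolarCount_le (h3 : (3 : K) ≠ 0) {g : Fin 4 → K}
    (hg : ∀ v, v ≠ 0 → ¬ DoubleRoot (assocForm g) v) :
    apolarCount g ≤ 2 * (Fintype.card K - 1) ^ 2 := by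
  by_cases hex : ∃ u w, cr u w ≠ 0 ∧ Apolar g u w
  swap
  · rw [apolarCount_eq_zero fun u w h h' => hex ⟨u, w, h, h'⟩]
    exact Nat.zero_le _
  obtain ⟨u, w, huw, h⟩ := hex
  have hα := h.tri_left h3 huw hg
  have hβ := h.tri_right h3 huw hg
  let S : Finset K := Finset.univ.erase 0
  have hS : (S ×ˢ S).card = (Fintype.card K - 1) ^ 2 := by
    rw [Finset.card_product, Finset.card_erase_of_mem (Finset.mem_univ _), Finset.card_univ, sq]
  have hsub : ((nonzeroForms K ×ˢ nonzeroForms K).filter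
      fun x => cr x.1 x.2 ≠ 0 ∧ Apolar g x.1 x.2) ⊆
      (S ×ˢ S).image (fun c => (c.1 • u, c.2 • w)) ∪
        (S ×ˢ S).image (fun c => (c.1 • w, c.2 • u)) := by
    rintro ⟨ℓ, m⟩ hx
    obtain ⟨-, hcr, hap⟩ := Finset.mem_filter.1 hx
    simp only at hcr hap
    obtain ⟨a, b, rfl⟩ := exists_combination huw ℓ
    obtain ⟨c, d, rfl⟩ := exists_combination huw m
    have h1 := hap ((1 : K) • u + (0 : K) • w)
    have h2 := hap ((0 : K) • u + (1 : K) • w)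
    rw [h.tri_eq] at h1 h2
    replace h1 : a = 0 ∨ c = 0 := by simpa [hα] using h1
    replace h2 : b = 0 ∨ d = 0 := by simpa [hβ] using h2
    rw [cr_combination] at hcr
    have hne : a * d - b * c ≠ 0 := fun h => hcr (by rw [h, zero_mul])
    rw [Finset.mem_union, Finset.mem_image, Finset.mem_image]
    clear hap
    rcases h1 with h1 | h1 <;> rcases h2 with h2 | h2 <;> subst h1 <;> subst h2
    · simp at hne
    · right
      refine ⟨(b, c), ?_, by simp⟩
      simpa [S, not_or] using hne
    · left
      refine ⟨(a, d), ?_, by simp⟩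
      simpa [S, not_or] using hne
    · simp at hne
  calc apolarCount g ≤ _ := Finset.card_le_card hsub
    _ ≤ _ := Finset.card_union_le _ _
    _ ≤ (S ×ˢ S).card + (S ×ˢ S).card := add_le_add Finset.card_image_le Finset.card_image_le
    _ = _ := by rw [hS]; ring

lemma exists_cube_root_of_unity (h : Fintype.card K % 3 = 1) : ∃ ω : K, ω ^ 3 = 1 ∧ ω ≠ 1 := by
  have h1 : 3 ∣ Fintype.card Kˣ := by
    rw [Fintype.card_units]
    omega
  obtain ⟨x, hx⟩ := exists_prime_orderOf_dvd_card 3 h1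
  refine ⟨x, ?_, ?_⟩
  · rw [← Units.val_pow_eq_pow_val, ← hx, pow_orderOf_eq_one, Units.val_one]
  · intro h'
    rw [Units.val_eq_one.1 h', orderOf_one] at hx
    omega

lemma cube_bijective (h : Fintype.card K % 3 = 2) : Function.Bijective fun x : K => x ^ 3 := by
  have h1 : (Nat.card Kˣ).Coprime 3 := by
    rw [Nat.card_eq_fintype_card, Fintype.card_units, Nat.coprime_comm,
      Nat.Prime.coprime_iff_not_dvd Nat.prime_three]
    omega
  rw [← Finite.injective_iff_bijective]
  intro x y hxy
  simp only at hxy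
  by_cases hx : x = 0
  · subst hx
    rw [zero_pow three_ne_zero] at hxy
    exact (pow_eq_zero_iff three_ne_zero |>.1 hxy.symm).symm
  have hy : y ≠ 0 := by
    rintro rfl
    rw [zero_pow three_ne_zero] at hxy
    exact hx (pow_eq_zero_iff three_ne_zero |>.1 hxy)
  have : Units.mk0 x hx = Units.mk0 y hy := 
    (powCoprime h1).injective (Units.ext (by simpa using hxy))
  exact congrArg Units.val this

end Apolarity

section Fourier

variable {p : ℕ} [Fact p.Prime]

lemma three_ne_zero_zmod (hp3 : p ≠ 3) : (3 : ZMod p) ≠ 0 := by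
  intro h
  have h1 : p ∣ 3 := (ZMod.natCast_eq_zero_iff 3 p).1 (by exact_mod_cast h)
  exact hp3 ((Nat.prime_dvd_prime_iff_eq Fact.out Nat.prime_three).1 h1)

lemma cardC_zmod : cardC (ZMod p) = p := by
  rw [cardC, ZMod.card]

lemma natCast_ne_zero_of_prime : (p : ℂ) ≠ 0 := by
  exact_mod_cast (Fact.out : p.Prime).ne_zero

lemma natCast_sub_one_ne_zero_of_prime : (p : ℂ) - 1 ≠ 0 := by
  simpa [cardC_zmod] using cardC_sub_one_ne_zero (K := ZMod p)

lemma bcfPair_add_left (f f' g : Fin 4 → ZMod p) :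
    bcfPair (f + f') g = bcfPair f g + bcfPair f' g := by
  simp [bcfPair]
  ring

/-- The character `f ↦ e^{2πi[f,g]/p}`. -/
def pairChar (f g : Fin 4 → ZMod p) : ℂ := ZMod.stdAddChar (bcfPair f g)

lemma pairChar_eq_exp (f g : Fin 4 → ZMod p) :
    pairChar f g =
      Complex.exp (2 * Real.pi * Complex.I * (ZMod.val (bcfPair f g) : ℂ) / (p : ℂ)) := by
  rw [pairChar, ZMod.stdAddChar_apply, ZMod.toCircle_apply]

lemma sum_pairChar {k : ℕ} (φ : (Fin k → ZMod p) →+ (Fin 4 → ZMod p)) (g : Fin 4 → ZMod p) :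
    ∑ L, pairChar (φ L) g = (p : ℂ) ^ k * ind (∀ L, bcfPair (φ L) g = 0) := by
  let χ : AddChar (Fin k → ZMod p) ℂ :=
    ZMod.stdAddChar.compAddMonoidHom
      (AddMonoidHom.mk' (fun L => bcfPair (φ L) g) fun L M => by
        rw [map_add, bcfPair_add_left])
  have hχ : ∀ L, χ L = pairChar (φ L) g := fun L => rfl
  have h0 : χ = 0 ↔ ∀ L, bcfPair (φ L) g = 0 := by
    constructor
    · intro h L
      apply ZMod.injective_stdAddChar
      change χ L = _
      rw [h]
      simp
    · intro h
      ext L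
      rw [hχ, pairChar, h L]
      simp
  rw [← Finset.sum_congr rfl fun L _ => hχ L, AddChar.sum_eq_ite]
  by_cases h : χ = 0
  · rw [if_pos h, ind_true (h0.1 h)]
    simp
  · rw [if_neg h, ind_false fun h' => h (h0.2 h')]
    simp

/-- The Fourier transform of the indicator of a parametrized subspace. -/
lemma sum_ind_mul_pairChar {k : ℕ} (φ : (Fin k → ZMod p) → (Fin 4 → ZMod p))
    (hadd : ∀ L M, φ (L + M) = φ L + φ M) (hinj : ∀ L, φ L = 0 → L = 0)
    {P : (Fin 4 → ZMod p) → Prop} (hP : ∀ f, P f ↔ ∃ L, φ L = f) (g : Fin 4 → ZMod p) :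
    ∑ f, ind (P f) * pairChar f g = (p : ℂ) ^ k * ind (∀ L, bcfPair (φ L) g = 0) := by
  have inj : Function.Injective φ :=
    (injective_iff_map_eq_zero (AddMonoidHom.mk' φ hadd)).2 hinj
  refine Eq.trans ?_ (sum_pairChar (AddMonoidHom.mk' φ hadd) g)
  have h1 : ∑ f, ind (P f) * pairChar f g = ∑ f ∈ Finset.univ.image φ, pairChar f g := by
    rw [← Finset.sum_subset (Finset.subset_univ (Finset.univ.image φ))]
    · refine Finset.sum_congr rfl fun f hf => ?_
      rw [ind_true ((hP f).2 (by simpa using hf)), one_mul]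
    · intro f _ hf
      rw [ind_false fun h => hf (by simpa using (hP f).1 h), zero_mul]
  rw [h1, Finset.sum_image fun a _ b _ h => inj h]
  rfl

lemma sum_pairChar_left (g : Fin 4 → ZMod p) :
    ∑ f, pairChar f g = (p : ℂ) ^ 4 * ind (g = 0) := by
  have h := sum_pairChar (AddMonoidHom.id (Fin 4 → ZMod p)) g
  have e : (∀ L : Fin 4 → ZMod p, bcfPair L g = 0) ↔ g = 0 := by
    constructor
    · intro h
      have h0 := h ![0, 0, 0, 1]
      have h1 := h ![0, 0, 1, 0]
      have h2 := h ![0, 1, 0, 0]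
      have h3 := h ![1, 0, 0, 0]
      simp [bcfPair] at h0 h1 h2 h3
      ext i
      fin_cases i <;> simp [h0, h1, h2, h3]
    · rintro rfl L
      simp [bcfPair]
  simpa [e] using h

lemma sum_pairChar_right (f : Fin 4 → ZMod p) :
    ∑ g, pairChar f g = (p : ℂ) ^ 4 * ind (f = 0) := by
  rw [← sum_pairChar_left f]
  refine Fintype.sum_equiv (Equiv.neg _) _ _ fun g => ?_
  rw [pairChar, pairChar]
  congr 1
  simp [bcfPair]
  ring

lemma sum_root_mul_pairChar (hp3 : p ≠ 3) {ℓ : ZMod p × ZMod p} (hℓ : ℓ ≠ 0)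
    (g : Fin 4 → ZMod p) :
    ∑ f, ind (Root f ℓ) * pairChar f g = (p : ℂ) ^ 3 * ind (TripleRoot (assocForm g) ℓ) := by
  rw [sum_ind_mul_pairChar (fun L : Fin 3 → ZMod p => linQuadProd ℓ.1 ℓ.2 (L 0) (L 1) (L 2))
    ?_ ?_ (root_iff_exists hℓ), tripleRoot_assocForm (three_ne_zero_zmod hp3)]
  · intro L M
    ext i
    fin_cases i <;> simp [linQuadProd] <;> ring
  · intro L h
    obtain ⟨h0, h1, h2⟩ := linQuadProd_eq_zero hℓ h
    ext i
    fin_cases i <;> simp [h0, h1, h2]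

lemma linProd_add (ℓ m : ZMod p × ZMod p) (a b c d : ZMod p) :
    linProd ℓ.1 ℓ.2 m.1 m.2 (a + c) (b + d) =
      linProd ℓ.1 ℓ.2 m.1 m.2 a b + linProd ℓ.1 ℓ.2 m.1 m.2 c d := by
  ext i
  fin_cases i <;> simp [linProd] <;> ring

lemma linProd_fin_two_eq_zero {ℓ m : ZMod p × ZMod p} (hℓ : ℓ ≠ 0) (hm : m ≠ 0)
    (L : Fin 2 → ZMod p) (h : linProd ℓ.1 ℓ.2 m.1 m.2 (L 0) (L 1) = 0) : L = 0 := by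
  have := linProd_eq_zero (n := (L 0, L 1)) hℓ hm h
  simp only [Prod.mk_eq_zero] at this
  ext i
  fin_cases i <;> simp [this]

lemma forall_fin_two_iff (g : Fin 4 → ZMod p) (ℓ m : ZMod p × ZMod p) :
    (∀ L : Fin 2 → ZMod p, bcfPair (linProd ℓ.1 ℓ.2 m.1 m.2 (L 0) (L 1)) g = 0) ↔
      Apolar g ℓ m :=
  ⟨fun h n => h ![n.1, n.2], fun h L => h (L 0, L 1)⟩

lemma sum_root_pair_mul_pairChar {ℓ m : ZMod p × ZMod p} (h : cr ℓ m ≠ 0)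
    (g : Fin 4 → ZMod p) :
    ∑ f, ind (Root f ℓ ∧ Root f m) * pairChar f g = (p : ℂ) ^ 2 * ind (Apolar g ℓ m) := by
  obtain ⟨hℓ, hm⟩ := fst_or_snd_ne_zero_of_cr_ne_zero h
  rw [sum_ind_mul_pairChar
    (fun L : Fin 2 → ZMod p => linProd ℓ.1 ℓ.2 m.1 m.2 (L 0) (L 1))
    (fun L M => linProd_add ℓ m _ _ _ _) (linProd_fin_two_eq_zero hℓ hm)
    (root_pair_iff_exists h), forall_fin_two_iff]

lemma sum_doubleRoot_mul_pairChar (hp3 : p ≠ 3) {ℓ : ZMod p × ZMod p} (hℓ : ℓ ≠ 0)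
    (g : Fin 4 → ZMod p) :
    ∑ f, ind (DoubleRoot f ℓ) * pairChar f g =
      (p : ℂ) ^ 2 * ind (DoubleRoot (assocForm g) ℓ) := by
  rw [sum_ind_mul_pairChar
    (fun L : Fin 2 → ZMod p => linProd ℓ.1 ℓ.2 ℓ.1 ℓ.2 (L 0) (L 1))
    (fun L M => linProd_add ℓ ℓ _ _ _ _) (linProd_fin_two_eq_zero hℓ hℓ)
    (doubleRoot_iff_exists (three_ne_zero_zmod hp3) hℓ), forall_fin_two_iff,
    doubleRoot_assocForm (three_ne_zero_zmod hp3), Apolar]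

lemma sum_tripleRoot_mul_pairChar (hp3 : p ≠ 3) {ℓ : ZMod p × ZMod p} (hℓ : ℓ ≠ 0)
    (g : Fin 4 → ZMod p) :
    ∑ f, ind (TripleRoot f ℓ) * pairChar f g = (p : ℂ) * ind (Root (assocForm g) ℓ) := by
  rw [sum_ind_mul_pairChar
    (fun L : Fin 1 → ZMod p => linProd ℓ.1 ℓ.2 ℓ.1 ℓ.2 (L 0 * ℓ.1) (L 0 * ℓ.2)) ?_ ?_
    (tripleRoot_iff_exists (three_ne_zero_zmod hp3) hℓ), pow_one, root_assocForm]
  · congr 2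
    refine propext ⟨fun h => ?_, fun h L => ?_⟩
    · simpa [tri] using h 1
    · have := tri_combination g ℓ ℓ ℓ 0 (L 0) 0
      rw [h] at this
      simpa [tri] using this
  · intro L M
    rw [← linProd_add]
    simp [add_mul]
  · intro L h
    have h1 := linProd_eq_zero (n := L 0 • ℓ) hℓ hℓ h
    ext i
    fin_cases i
    simpa [hℓ] using h1

/-- The unnormalized Fourier transform of the indicator of the orbit of type `τ`. -/
def typeSum (τ : FpType) (g : Fin 4 → ZMod p) : ℂ :=
  ∑ f, ind (HasFpType f τ) * pairChar f g

lemma sum_mul_pairChar_of_type (hp3 : p ≠ 3) {H : (Fin 4 → ZMod p) → ℂ} {h : FpType → ℂ}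
    (hH : ∀ f τ, HasFpType f τ → H f = h τ) (g : Fin 4 → ZMod p) :
    ∑ f, H f * pairChar f g =
      h FpType.t0 * typeSum FpType.t0 g + h FpType.t13 * typeSum FpType.t13 g +
        h FpType.t121 * typeSum FpType.t121 g + h FpType.t111 * typeSum FpType.t111 g +
        h FpType.t12 * typeSum FpType.t12 g + h FpType.t3 * typeSum FpType.t3 g := by
  simp only [typeSum, Finset.mul_sum, ← Finset.sum_add_distrib]
  refine Finset.sum_congr rfl fun f _ => ?_
  obtain ⟨τ, hτ⟩ := exists_hasFpType f
  have key : ∀ σ, ind (HasFpType f σ) = ind (σ = τ) := fun σ => by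
    congr 1
    refine propext ⟨fun hσ => hσ.unique (three_ne_zero_zmod hp3) hτ, ?_⟩
    rintro rfl
    exact hτ
  simp only [key, hH f τ hτ]
  cases τ <;> simp [ind]

lemma typeSum_t0 (g : Fin 4 → ZMod p) : typeSum FpType.t0 g = 1 := by
  rw [typeSum, Finset.sum_eq_single 0]
  · rw [ind_true (show HasFpType (0 : Fin 4 → ZMod p) FpType.t0 from rfl)]
    simp [pairChar, bcfPair]
  · intro f _ hf
    rw [ind_false (show ¬ HasFpType f FpType.t0 from hf), zero_mul]
  · simp

lemma sum_forms_swap {H : (Fin 4 → ZMod p) → ZMod p × ZMod p → ℂ} (g : Fin 4 → ZMod p) :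
    ∑ f, (∑ ℓ ∈ nonzeroForms (ZMod p), H f ℓ) * pairChar f g =
      ∑ ℓ ∈ nonzeroForms (ZMod p), ∑ f, H f ℓ * pairChar f g := by
  rw [Finset.sum_comm]
  simp only [Finset.sum_mul]

lemma typeSum_root (hp3 : p ≠ 3) {g : Fin 4 → ZMod p} {σ : FpType}
    (hg : HasFpType (assocForm g) σ) :
    ((p : ℂ) + 1) + typeSum FpType.t13 g + 2 * typeSum FpType.t121 g +
        3 * typeSum FpType.t111 g + typeSum FpType.t12 g =
      (p : ℂ) ^ 3 * tripleTable p σ := by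
  have h := sum_mul_pairChar_of_type hp3 (fun f τ hf => sum_root hf) g
  rw [sum_forms_swap, Finset.sum_congr rfl fun ℓ hℓ =>
    sum_root_mul_pairChar hp3 (mem_nonzeroForms.1 hℓ) g, ← Finset.mul_sum,
    sum_tripleRoot (three_ne_zero_zmod hp3) hg, typeSum_t0, cardC_zmod] at h
  refine mul_left_cancel₀ (natCast_sub_one_ne_zero_of_prime (p := p)) ?_
  simp only [rootTable] at h
  linear_combination -h

lemma typeSum_doubleRoot (hp3 : p ≠ 3) {g : Fin 4 → ZMod p} {σ : FpType}
    (hg : HasFpType (assocForm g) σ) :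
    ((p : ℂ) + 1) + typeSum FpType.t13 g + typeSum FpType.t121 g =
      (p : ℂ) ^ 2 * doubleTable p σ := by
  have h := sum_mul_pairChar_of_type hp3
    (fun f τ hf => sum_doubleRoot (three_ne_zero_zmod hp3) hf) g
  rw [sum_forms_swap, Finset.sum_congr rfl fun ℓ hℓ =>
    sum_doubleRoot_mul_pairChar hp3 (mem_nonzeroForms.1 hℓ) g, ← Finset.mul_sum,
    sum_doubleRoot (three_ne_zero_zmod hp3) hg, typeSum_t0, cardC_zmod] at h
  refine mul_left_cancel₀ (natCast_sub_one_ne_zero_of_prime (p := p)) ?_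
  cases σ <;> simp only [doubleTable] at h ⊢ <;> linear_combination -h

lemma typeSum_tripleRoot (hp3 : p ≠ 3) {g : Fin 4 → ZMod p} {σ : FpType}
    (hg : HasFpType (assocForm g) σ) :
    ((p : ℂ) + 1) + typeSum FpType.t13 g = (p : ℂ) * rootTable p σ := by
  have h := sum_mul_pairChar_of_type hp3
    (fun f τ hf => sum_tripleRoot (three_ne_zero_zmod hp3) hf) g
  rw [sum_forms_swap, Finset.sum_congr rfl fun ℓ hℓ =>
    sum_tripleRoot_mul_pairChar hp3 (mem_nonzeroForms.1 hℓ) g, ← Finset.mul_sum,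
    sum_root hg, typeSum_t0, cardC_zmod] at h
  refine mul_left_cancel₀ (natCast_sub_one_ne_zero_of_prime (p := p)) ?_
  simp only [tripleTable] at h
  linear_combination -h

lemma sum_rootPairs_mul_pairChar (g : Fin 4 → ZMod p) :
    ∑ f, (∑ ℓ ∈ nonzeroForms (ZMod p), ∑ m ∈ nonzeroForms (ZMod p),
        ind (cr ℓ m ≠ 0 ∧ Root f ℓ ∧ Root f m)) * pairChar f g =
      (p : ℂ) ^ 2 * apolarCount g := by
  rw [sum_forms_swap, cast_apolarCount, Finset.mul_sum]
  refine Finset.sum_congr rfl fun ℓ _ => ?_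
  rw [sum_forms_swap, Finset.mul_sum]
  refine Finset.sum_congr rfl fun m _ => ?_
  simp only [ind_and (cr ℓ m ≠ 0)]
  by_cases h : cr ℓ m = 0
  · simp [ind, h]
  · simp only [ind_true h, one_mul]
    exact sum_root_pair_mul_pairChar h g

lemma typeSum_rootPairs (hp3 : p ≠ 3) {g : Fin 4 → ZMod p} {B : ℂ}
    (hB : (apolarCount g : ℂ) = ((p : ℂ) - 1) ^ 2 * B) :
    ((p : ℂ) + 1) * p + 2 * typeSum FpType.t121 g + 6 * typeSum FpType.t111 g =
      (p : ℂ) ^ 2 * B := by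
  have h := sum_mul_pairChar_of_type hp3 (fun f τ hf => sum_root_pair hf) g
  rw [sum_rootPairs_mul_pairChar, hB, typeSum_t0, cardC_zmod] at h
  refine mul_left_cancel₀ (pow_ne_zero 2 (natCast_sub_one_ne_zero_of_prime (p := p))) ?_
  simp only [rootTable] at h
  linear_combination -h

lemma assocForm_eq_zero (hp3 : p ≠ 3) {g : Fin 4 → ZMod p} : assocForm g = 0 ↔ g = 0 := by
  constructor
  · intro h
    have h0 := congrFun h 0
    have h1 := congrFun h 1
    have h2 := congrFun h 2
    have h3 := congrFun h 3
    simp [assocForm, three_ne_zero_zmod hp3] at h0 h1 h2 h3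
    ext i
    fin_cases i <;> simp [h0, h1, h2, h3]
  · rintro rfl
    ext i
    fin_cases i <;> simp [assocForm]

lemma typeSum_total (hp3 : p ≠ 3) {g : Fin 4 → ZMod p} {σ : FpType}
    (hg : HasFpType (assocForm g) σ) :
    1 + typeSum FpType.t13 g + typeSum FpType.t121 g + typeSum FpType.t111 g +
        typeSum FpType.t12 g + typeSum FpType.t3 g =
      (p : ℂ) ^ 4 * ind (σ = FpType.t0) := by
  have h := sum_mul_pairChar_of_type hp3 (H := fun _ => 1) (h := fun _ => 1)
    (fun _ _ _ => rfl) g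
  have e : ind (g = 0) = ind (σ = FpType.t0) := by
    congr 1
    rw [← assocForm_eq_zero hp3]
    refine propext ⟨fun h0 => hg.unique (three_ne_zero_zmod hp3) h0, ?_⟩
    rintro rfl
    exact hg
  simp only [one_mul, sum_pairChar_left, typeSum_t0, e] at h
  exact h.symm

/-- The number of ordered pairs of independent points whose product is apolar to an element
of the dual space of given type. -/
def apolarTable (q : ℕ) : FpType → ℕ
  | FpType.t0 => q * (q + 1)
  | FpType.t13 => 2 * q
  | FpType.t121 => 0
  | FpType.t111 => if q % 3 = 1 then 2 else 0
  | FpType.t12 => if q % 3 = 1 then 0 else 2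
  | FpType.t3 => if q % 3 = 1 then 2 else 0

lemma mod_three_cases (hp3 : p ≠ 3) : p % 3 = 1 ∨ p % 3 = 2 := by
  have : ¬ 3 ∣ p := fun h =>
    hp3 ((Nat.prime_dvd_prime_iff_eq Nat.prime_three Fact.out).1 h).symm
  omega

lemma apolarCount_le_table (hp3 : p ≠ 3) {g : Fin 4 → ZMod p} {σ : FpType}
    (hg : HasFpType (assocForm g) σ) :
    apolarCount g ≤ (p - 1) ^ 2 * apolarTable p σ := by
  have h3 := three_ne_zero_zmod hp3
  have hp1 : 1 ≤ p := (Fact.out : p.Prime).one_lt.le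
  have hle : σ.Separable → apolarCount g ≤ (p - 1) ^ 2 * 2 := fun hσ => by
    have := apolarCount_le h3 fun v hv => not_doubleRoot_of_separable h3 hg hσ hv
    rwa [ZMod.card, mul_comm] at this
  cases σ with
  | t0 =>
    refine le_of_eq ?_
    have := apolarCount_t0 h3 hg
    rw [cardC_zmod] at this
    apply Nat.cast_injective (R := ℂ)
    rw [this, apolarTable]
    push_cast [hp1]
    ring
  | t13 =>
    refine le_of_eq ?_
    have := apolarCount_t13 h3 hg
    rw [cardC_zmod] at this
    apply Nat.cast_injective (R := ℂ)
    rw [this, apolarTable]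
    push_cast [hp1]
    ring
  | t121 =>
    rw [apolarCount_eq_zero fun u w huw => not_apolar_t121 h3 hg huw]
    exact Nat.zero_le _
  | t111 =>
    rcases mod_three_cases hp3 with h | h
    · simpa [apolarTable, h] using hle trivial
    · rw [apolarCount_eq_zero fun u w huw =>
        not_apolar_t111 h3 (cube_bijective (by rwa [ZMod.card])).1 hg huw]
      exact Nat.zero_le _
  | t12 =>
    rcases mod_three_cases hp3 with h | h
    · obtain ⟨ω, hω, hω1⟩ := exists_cube_root_of_unity (K := ZMod p) (by rwa [ZMod.card])
      rw [apolarCount_eq_zero fun u w huw => not_apolar_t12 h3 hω hω1 hg huw]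
      exact Nat.zero_le _
    · simpa [apolarTable, h] using hle trivial
  | t3 =>
    rcases mod_three_cases hp3 with h | h
    · simpa [apolarTable, h] using hle trivial
    · rw [apolarCount_eq_zero fun u w huw =>
        not_apolar_t3 h3 (cube_bijective (by rwa [ZMod.card])).2 hg huw]
      exact Nat.zero_le _

lemma sum_apolarCount :
    ∑ g : Fin 4 → ZMod p, (apolarCount g : ℂ) =
      (p : ℂ) ^ 2 * (((p : ℂ) - 1) ^ 2 * (p * (p + 1))) := by
  refine mul_left_cancel₀ (pow_ne_zero 2 (natCast_ne_zero_of_prime (p := p))) ?_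
  rw [Finset.mul_sum, Finset.sum_congr rfl fun g _ => (sum_rootPairs_mul_pairChar g).symm,
    Finset.sum_comm]
  simp only [← Finset.mul_sum, sum_pairChar_right]
  rw [Finset.sum_eq_single 0]
  · rw [ind_true rfl, sum_root_pair (τ := FpType.t0) rfl, cardC_zmod, rootTable]
    ring
  · intro f _ hf
    rw [ind_false hf]
    ring
  · simp

/-- The type of a binary cubic form. -/
def typeOf (f : Fin 4 → ZMod p) : FpType := (exists_hasFpType f).choose

lemma hasFpType_typeOf (f : Fin 4 → ZMod p) : HasFpType f (typeOf f) :=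
  (exists_hasFpType f).choose_spec

lemma assocForm_bijective (hp3 : p ≠ 3) :
    Function.Bijective (assocForm : (Fin 4 → ZMod p) → Fin 4 → ZMod p) := by
  rw [← Finite.injective_iff_bijective]
  intro g g' h
  rw [← sub_eq_zero, ← assocForm_eq_zero hp3]
  rw [← sub_eq_zero] at h
  rw [← h]
  ext i
  fin_cases i <;> simp [assocForm] <;> ring

lemma sum_apolarTable (hp3 : p ≠ 3) :
    ∑ g : Fin 4 → ZMod p, (apolarTable p (typeOf (assocForm g)) : ℂ) =
      (p : ℂ) ^ 2 * (p * (p + 1)) := by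
  have h3 := three_ne_zero_zmod hp3
  rw [(assocForm_bijective hp3).sum_comp fun f => (apolarTable p (typeOf f) : ℂ)]
  have h := sum_mul_pairChar_of_type hp3 (H := fun f => (apolarTable p (typeOf f) : ℂ))
    (h := fun τ => (apolarTable p τ : ℂ))
    (fun f τ hf => by rw [(hasFpType_typeOf f).unique h3 hf]) 0
  have hchar : ∀ f : Fin 4 → ZMod p, pairChar f 0 = 1 := fun f => by simp [pairChar, bcfPair]
  simp only [hchar, mul_one] at h
  rw [h]
  have hg : HasFpType (assocForm (0 : Fin 4 → ZMod p)) FpType.t0 := (assocForm_eq_zero hp3).2 rfl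
  have hB := apolarCount_t0 h3 hg
  rw [cardC_zmod] at hB
  have e1 := typeSum_tripleRoot hp3 hg
  have e2 := typeSum_doubleRoot hp3 hg
  have e3 := typeSum_rootPairs hp3 hB
  have e4 := typeSum_root hp3 hg
  have e5 := typeSum_total hp3 hg
  have e0 := typeSum_t0 (0 : Fin 4 → ZMod p)
  rw [ind_true rfl] at e5
  simp only [rootTable, doubleTable, tripleTable] at e1 e2 e4
  generalize typeSum FpType.t0 (0 : Fin 4 → ZMod p) = s0 at *
  generalize typeSum FpType.t13 (0 : Fin 4 → ZMod p) = s13 at *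
  generalize typeSum FpType.t121 (0 : Fin 4 → ZMod p) = s121 at *
  generalize typeSum FpType.t111 (0 : Fin 4 → ZMod p) = s111 at *
  generalize typeSum FpType.t12 (0 : Fin 4 → ZMod p) = s12 at *
  generalize typeSum FpType.t3 (0 : Fin 4 → ZMod p) = s3 at *
  have v13 : s13 = ((p : ℂ) + 1) * (p - 1) := by linear_combination e1
  have v121 : s121 = p * ((p : ℂ) + 1) * (p - 1) := by linear_combination e2 - e1
  have v111 : s111 = p * ((p : ℂ) + 1) * (p - 1) ^ 2 / 6 := by
    linear_combination e3 / 6 - v121 / 3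
  have v12 : s12 = p * ((p : ℂ) + 1) * (p - 1) ^ 2 / 2 := by
    linear_combination e4 - v13 - 2 * v121 - 3 * v111
  have v3 : s3 = p * ((p : ℂ) + 1) * (p - 1) ^ 2 / 3 := by
    linear_combination e5 - v13 - v121 - v111 - v12
  rcases mod_three_cases hp3 with hm | hm <;> simp [apolarTable, hm, e0, v13, v121, v111, v12, v3]
    <;> ring

lemma apolarCount_eq_table (hp3 : p ≠ 3) {g : Fin 4 → ZMod p} {σ : FpType}
    (hg : HasFpType (assocForm g) σ) :
    (apolarCount g : ℂ) = ((p : ℂ) - 1) ^ 2 * apolarTable p σ := by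
  have hp1 : 1 ≤ p := (Fact.out : p.Prime).one_lt.le
  have hsum : ∑ g : Fin 4 → ZMod p, apolarCount g =
      ∑ g : Fin 4 → ZMod p, (p - 1) ^ 2 * apolarTable p (typeOf (assocForm g)) := by
    apply Nat.cast_injective (R := ℂ)
    push_cast [hp1]
    rw [sum_apolarCount, ← Finset.mul_sum, sum_apolarTable hp3]
    ring
  have := (Finset.sum_eq_sum_iff_of_le fun g _ =>
    apolarCount_le_table hp3 (hasFpType_typeOf (assocForm g))).1 hsum g (Finset.mem_univ _)
  rw [this, (hasFpType_typeOf (assocForm g)).unique (three_ne_zero_zmod hp3) hg]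
  push_cast [hp1]
  ring

lemma bcfFourier_eq_typeSum (τ : FpType) (g : Fin 4 → ZMod p) :
    bcfFourier p (fun f => if HasFpType f τ then 1 else 0) g =
      ((p : ℂ) ^ 4)⁻¹ * typeSum τ g := by
  rw [bcfFourier, tsum_fintype, typeSum]
  congr 1
  refine Finset.sum_congr rfl fun f _ => ?_
  rw [← pairChar_eq_exp, mul_comm]
  rfl

end Fourier

/-- Mori's computation of the Fourier transforms of the characteristic functions of the
`GL₂(𝔽_p)`-orbits on the space of binary cubic forms over `𝔽_p`, for `p ≠ 3`:
on the dual orbit of type `σ`, the Fourier transform of the characteristic function of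
the orbit of type `τ` takes the value `m_{στ}`. -/
theorem fourier_of_orbit_indicators (p : ℕ) [Fact p.Prime] (hp3 : p ≠ 3)
    (τ : FpType) (g : Fin 4 → ZMod p) (σ : FpType) (hg : HasDualFpType g σ) :
    bcfFourier p (fun f => if HasFpType f τ then 1 else 0) g = (moriEntry p σ τ : ℂ) := by
  have hg' : HasFpType (assocForm g) σ := hg
  have e0 := typeSum_t0 g
  have e1 := typeSum_tripleRoot hp3 hg'
  have e2 := typeSum_doubleRoot hp3 hg'
  have e3 := typeSum_rootPairs hp3 (apolarCount_eq_table hp3 hg')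
  have e4 := typeSum_root hp3 hg'
  have e5 := typeSum_total hp3 hg'
  have v13 : typeSum FpType.t13 g = p * rootTable p σ - (p + 1) := by linear_combination e1
  have v121 : typeSum FpType.t121 g = p ^ 2 * doubleTable p σ - p * rootTable p σ := by
    linear_combination e2 - e1
  have v111 := eq_div_of_mul_eq (by norm_num : (6 : ℂ) ≠ 0)
    (by linear_combination e3 - 2 * v121 : typeSum FpType.t111 g * 6 =
      p ^ 2 * apolarTable p σ - (p + 1) * p -
        2 * (p ^ 2 * doubleTable p σ - p * rootTable p σ))
  have v12 := eq_sub_of_add_eq' e4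
  have v3 := eq_sub_of_add_eq' e5
  rw [bcfFourier_eq_typeSum]
  rcases mod_three_cases hp3 with hm | hm <;> cases τ <;> cases σ <;>
    simp only [moriEntry, e0, v3, v12, v111, v121, v13, rootTable, doubleTable, tripleTable,
      apolarTable, hm, ind, reduceCtorEq, if_true, if_false, OfNat.ofNat_ne_one] <;>
    push_cast <;> ring
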